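/- There exists a constant C > 0 (depending only on the distribution of ξ) such that for all integers k ≥ 1 and n ≥ 1 (with P(|𝒯| = n) > 0), E Z_k(T_n^*) ≤ C k, where T_n^* is the conditioned Galton–Watson tree T_n rerooted at a uniformly random vertex. -/

import Mathlib

open scoped ENNReal BigOperators
open Set Filter

/-- Plane (ordered rooted) trees. -/
inductive PlaneTree : Type
  | node : List PlaneTree → PlaneTree

namespace PlaneTree

/-- The list of subtrees hanging off the root. -/
def children : PlaneTree → List PlaneTree
  | .node ts => ts

/-- The subtree rooted at a given position (sequence of child indices), if it exists. -/
def subtreeAt : PlaneTree → List ℕ → Option PlaneTree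
  | t, [] => some t
  | .node ts, i :: q =>
    match ts[i]? with
    | some t' => subtreeAt t' q
    | none => none

/-- The vertex set of a tree, with vertices identified with their positions. -/
def vertexSet (t : PlaneTree) : Set (List ℕ) := {q | (subtreeAt t q).isSome}

/-- The number of vertices of a tree. -/
noncomputable def size (t : PlaneTree) : ℕ := (vertexSet t).ncard

/-- The number of children of the vertex at position `q`. -/
def childCount (t : PlaneTree) (q : List ℕ) : ℕ :=
  ((subtreeAt t q).map fun t' => t'.children.length).getD 0

end PlaneTree

/-- Longest common prefix of two positions; this is the position of the last common
ancestor of the two vertices. -/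
def lca : List ℕ → List ℕ → List ℕ
  | a :: as, b :: bs => if a = b then a :: lca as bs else []
  | _, _ => []

/-- The distance from `v` up to the last common ancestor of `v` and `w`. -/
def dUp (v w : List ℕ) : ℕ := v.length - (lca v w).length

/-- The graph distance between the vertices at positions `v` and `w`. -/
def treeDist (v w : List ℕ) : ℕ := dUp v w + dUp w v

/-- The Galton–Watson probability of a given finite tree: the product, over all vertices,
of the probability that the offspring distribution takes the value given by the number of
children of the vertex. -/
noncomputable def gwProb (p : ℕ → ℝ≥0∞) (t : PlaneTree) : ℝ≥0∞ :=
  ∏ᶠ v ∈ PlaneTree.vertexSet t, p (PlaneTree.childCount t v)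

/-- `P(|𝒯| = n)` for the Galton–Watson tree `𝒯`. -/
noncomputable def probSize (p : ℕ → ℝ≥0∞) (n : ℕ) : ℝ≥0∞ :=
  ∑' t : PlaneTree, if PlaneTree.size t = n then gwProb p t else 0

/-- `E f(T_n)` where `T_n` is the Galton–Watson tree conditioned to have `n` vertices. -/
noncomputable def condExp (p : ℕ → ℝ≥0∞) (n : ℕ) (f : PlaneTree → ℝ≥0∞) : ℝ≥0∞ :=
  (∑' t : PlaneTree, if PlaneTree.size t = n then gwProb p t * f t else 0) / probSize p n

/-- The variance of the offspring distribution `p` (which has mean `1`). -/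
noncomputable def xiVar (p : ℕ → ℝ≥0∞) : ℝ≥0∞ :=
  ∑' k : ℕ, p k * ENNReal.ofReal (((k : ℝ) - 1) ^ 2)

/-- `P_k(t)`: the number of unordered pairs of vertices of `t` at graph distance `k`. -/
noncomputable def pairCount (t : PlaneTree) (k : ℕ) : ℕ :=
  {s : Set (List ℕ) | ∃ v w, v ∈ PlaneTree.vertexSet t ∧ w ∈ PlaneTree.vertexSet t ∧
    s = {v, w} ∧ treeDist v w = k}.ncard

/-- `Z_k` of the tree `t` rerooted at `v`: the number of vertices of `t` at graph
distance `k` from the vertex `v`. -/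
noncomputable def rerootedZ (t : PlaneTree) (v : List ℕ) (k : ℕ) : ℕ :=
  {w | w ∈ PlaneTree.vertexSet t ∧ treeDist v w = k}.ncard

namespace GaltonWatson
open PowerSeries

/-- The power series `∑ⱼ q j * A ^ e j`, with coefficients in `ℝ≥0∞`. -/
noncomputable def powSum (q : ℕ → ℝ≥0∞) (e : ℕ → ℕ) (A : ℝ≥0∞⟦X⟧) : ℝ≥0∞⟦X⟧ :=
  .mk fun n => ∑' j, q j * coeff n (A ^ e j)

theorem coeff_powSum_mul (q : ℕ → ℝ≥0∞) (e : ℕ → ℕ) (A B : ℝ≥0∞⟦X⟧) (n : ℕ) :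
    coeff n (powSum q e A * B) = ∑' j, q j * coeff n (A ^ e j * B) := by
  simp only [coeff_mul, powSum, coeff_mk, Finset.mul_sum]
  rw [Summable.tsum_finsetSum fun _ _ => ENNReal.summable]
  simp only [← ENNReal.tsum_mul_right, mul_assoc]

theorem coeff_powSum (q : ℕ → ℝ≥0∞) (e : ℕ → ℕ) (A : ℝ≥0∞⟦X⟧) (n : ℕ) :
    coeff n (powSum q e A) = ∑' j, q j * coeff n (A ^ e j) := by
  simp [powSum]

/-- The geometric series `∑ᵢ W ^ i`. -/
noncomputable def geomSum (W : ℝ≥0∞⟦X⟧) : ℝ≥0∞⟦X⟧ := powSum (fun _ => 1) id W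

theorem geomSum_eq (W : ℝ≥0∞⟦X⟧) : geomSum W = 1 + W * geomSum W := by
  ext n
  rw [map_add, mul_comm W, geomSum, coeff_powSum_mul, coeff_powSum,
    tsum_eq_zero_add' ENNReal.summable]
  simp [pow_succ]

theorem eq_mul_geomSum {A B W V : ℝ≥0∞⟦X⟧} (hW : W = X * V) (h : A = B + W * A) :
    A = B * geomSum W := by
  have h' : B * geomSum W = B + W * (B * geomSum W) := by
    conv_lhs => rw [geomSum_eq]
    ring
  generalize B * geomSum W = A' at h'
  ext n
  induction n using Nat.strong_induction_on with
  | _ n ih =>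
    rw [h, h', map_add, map_add]
    congr 1
    cases n with
    | zero => simp [hW]
    | succ n =>
      rw [hW, mul_assoc, mul_assoc, coeff_succ_X_mul, coeff_succ_X_mul, coeff_mul, coeff_mul]
      refine Finset.sum_congr rfl fun x hx => ?_
      rw [ih x.2 (by have := Finset.HasAntidiagonal.mem_antidiagonal.1 hx; omega)]

/-- The generating function `∑ⱼ p j X ^ j`. -/
noncomputable def offspringGF (p : ℕ → ℝ≥0∞) : ℝ≥0∞⟦X⟧ := .mk p

theorem offspringGF_eq (p : ℕ → ℝ≥0∞) : offspringGF p = powSum p id X := by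
  ext n
  simp [offspringGF, coeff_powSum, coeff_X_pow]

theorem derivative_offspringGF (p : ℕ → ℝ≥0∞) :
    d⁄dX ℝ≥0∞ (offspringGF p) = powSum (fun j => j * p j) (· - 1) X := by
  ext n
  rw [coeff_derivative, coeff_powSum, tsum_eq_zero_add' ENNReal.summable]
  simp [offspringGF, coeff_X_pow, mul_comm]

theorem coeff_derivative_mul_pow (P : ℝ≥0∞⟦X⟧) (n : ℕ) :
    coeff n (d⁄dX ℝ≥0∞ P * P ^ n) = coeff (n + 1) (P ^ (n + 1)) := by
  have h := congrArg (coeff n) (derivative_pow P (n + 1))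
  rw [coeff_derivative, Nat.add_sub_cancel, mul_assoc, mul_comm _ ((n : ℝ≥0∞) + 1)] at h
  have h2 : (((n + 1 : ℕ) : ℝ≥0∞⟦X⟧)) = C ((n : ℝ≥0∞) + 1) := by simp
  rw [h2, coeff_C_mul, ENNReal.mul_right_inj (by simp) (by finiteness)] at h
  rw [h, mul_comm]

/-- The generating function `X * ∑ⱼ j p j Y ^ (j - 1)` of one step of a marked path. -/
noncomputable def spineGF (p : ℕ → ℝ≥0∞) (Y : ℝ≥0∞⟦X⟧) : ℝ≥0∞⟦X⟧ :=
  X * powSum (fun j => j * p j) (· - 1) Y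

/-- Lagrange inversion for `Y = X * ∑ⱼ p j Y ^ j`. -/
theorem coeff_pow_mul_geomSum {p : ℕ → ℝ≥0∞} {Y : ℝ≥0∞⟦X⟧} (hY : Y = X * powSum p id Y)
    (r n : ℕ) :
    coeff n (Y ^ r * geomSum (spineGF p Y)) = coeff n (X ^ r * offspringGF p ^ n) := by
  induction n generalizing r with
  | zero =>
    have h0 : constantCoeff (geomSum (spineGF p Y)) = 1 := by
      rw [geomSum_eq]; simp [spineGF]
    have h1 : constantCoeff Y = 0 := by rw [hY]; simp
    cases r <;> simp [h0, h1]
  | succ n ih =>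
    cases r with
    | zero =>
      rw [pow_zero, one_mul, pow_zero, one_mul, geomSum_eq, map_add, spineGF, mul_assoc,
        coeff_succ_X_mul, ← spineGF, coeff_powSum_mul]
      simp only [ih]
      rw [← coeff_powSum_mul, ← derivative_offspringGF, coeff_derivative_mul_pow]
      simp [coeff_one]
    | succ r =>
      have h : Y ^ (r + 1) * geomSum (spineGF p Y)
          = X * (powSum p id Y * (Y ^ r * geomSum (spineGF p Y))) := by
        rw [pow_succ]
        nth_rewrite 2 [hY]
        ring
      have h' : X ^ (r + 1) * offspringGF p ^ (n + 1)
          = X * (powSum p id X * (X ^ r * offspringGF p ^ n)) := by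
        rw [← offspringGF_eq]; ring
      rw [h, h', coeff_succ_X_mul, coeff_succ_X_mul, coeff_powSum_mul, coeff_powSum_mul]
      simp only [id, ← mul_assoc (_ ^ _) (_ ^ _), ← pow_add, ih]

theorem coeff_pow_mul_spineGF_pow {p : ℕ → ℝ≥0∞} {Y : ℝ≥0∞⟦X⟧} (B : ℝ≥0∞⟦X⟧) (r k n : ℕ) :
    coeff (n + 1) (Y ^ r * spineGF p Y ^ (k + 1) * B)
      = ∑' j : ℕ, (j * p j) * coeff n (Y ^ (j - 1 + r) * spineGF p Y ^ k * B) := by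
  have h : Y ^ r * spineGF p Y ^ (k + 1) * B
      = X * (powSum (fun j => j * p j) (· - 1) Y * (Y ^ r * spineGF p Y ^ k * B)) := by
    rw [pow_succ]
    nth_rewrite 2 [spineGF]
    ring
  rw [h, coeff_succ_X_mul, coeff_powSum_mul]
  simp only [pow_add, mul_assoc]

theorem coeff_pow_mul_spineGF_pow_eq_zero {p : ℕ → ℝ≥0∞} {Y : ℝ≥0∞⟦X⟧} (B : ℝ≥0∞⟦X⟧)
    {r k n : ℕ} (hk : n < k) : coeff n (Y ^ r * spineGF p Y ^ k * B) = 0 := by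
  have h : Y ^ r * spineGF p Y ^ k * B
      = X ^ k * (Y ^ r * powSum (fun j => j * p j) (· - 1) Y ^ k * B) := by
    rw [spineGF]; ring
  rw [h, coeff_X_pow_mul', if_neg (by omega)]

theorem coeff_pow_mul_spineGF_pow_le {p : ℕ → ℝ≥0∞} (hmean : ∑' k : ℕ, (k : ℝ≥0∞) * p k = 1)
    {Y : ℝ≥0∞⟦X⟧} (hY : Y = X * powSum p id Y) {N k : ℕ} {u : ℝ≥0∞}
    (hu : ∀ m, coeff m (offspringGF p ^ N) ≤ u) (r : ℕ) :
    coeff (N + k) (Y ^ r * spineGF p Y ^ k * geomSum (spineGF p Y)) ≤ u := by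
  induction k generalizing r with
  | zero =>
    rw [pow_zero, mul_one, coeff_pow_mul_geomSum hY, coeff_X_pow_mul']
    split_ifs
    · exact hu _
    · exact zero_le
  | succ k ih =>
    rw [← add_assoc, coeff_pow_mul_spineGF_pow]
    calc _ ≤ ∑' j : ℕ, (j * p j) * u := ENNReal.tsum_le_tsum fun j => by gcongr; exact ih _
      _ = u := by rw [ENNReal.tsum_mul_right, hmean, one_mul]

theorem coeff_offspringGF_pow_mul_le (p : ℕ → ℝ≥0∞) (x : ℝ≥0∞) (N m : ℕ) :
    coeff m (offspringGF p ^ N) * x ^ m ≤ (∑' j, p j * x ^ j) ^ N := by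
  induction N generalizing m with
  | zero => cases m <;> simp [coeff_one]
  | succ N ih =>
    have h : offspringGF p ^ (N + 1) = powSum p id X * offspringGF p ^ N := by
      rw [← offspringGF_eq, pow_succ']
    rw [h, coeff_powSum_mul, pow_succ', ← ENNReal.tsum_mul_right, ← ENNReal.tsum_mul_right]
    refine ENNReal.tsum_le_tsum fun j => ?_
    rw [id, coeff_X_pow_mul']
    split_ifs with hj
    · calc _ = p j * x ^ j * (coeff (m - j) (offspringGF p ^ N) * x ^ (m - j)) := by
            rw [← pow_mul_pow_sub x hj]; ring
        _ ≤ _ := by gcongr; exact ih _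
    · simp

/-- Chernoff bound for the coefficients of `Y ^ r * W ^ k / (1 - W)`. -/
theorem coeff_pow_mul_spineGF_pow_mul_le {p : ℕ → ℝ≥0∞}
    {Y : ℝ≥0∞⟦X⟧} (hY : Y = X * powSum p id Y) {x : ℝ≥0∞} (N k r : ℕ) :
    coeff (N + k) (Y ^ r * spineGF p Y ^ k * geomSum (spineGF p Y)) * x ^ (N + k)
      ≤ x ^ r * (x * ∑' j : ℕ, j * p j * x ^ (j - 1)) ^ k * (∑' j, p j * x ^ j) ^ N := by
  induction k generalizing r with
  | zero =>
    rw [pow_zero, mul_one, coeff_pow_mul_geomSum hY, coeff_X_pow_mul']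
    split_ifs with h
    · calc _ = x ^ r * (coeff (N - r) (offspringGF p ^ N) * x ^ (N - r)) := by
            rw [add_zero] at *
            rw [← pow_mul_pow_sub x h]; ring
        _ ≤ _ := by
            rw [pow_zero, mul_one]; gcongr; exact coeff_offspringGF_pow_mul_le _ _ _ _
    · simp
  | succ k ih =>
    rw [← add_assoc, coeff_pow_mul_spineGF_pow, ← ENNReal.tsum_mul_right]
    calc _ ≤ ∑' j : ℕ, (x * (j * p j * x ^ (j - 1))) *
          (x ^ r * (x * ∑' j : ℕ, j * p j * x ^ (j - 1)) ^ k * (∑' j, p j * x ^ j) ^ N) := by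
          refine ENNReal.tsum_le_tsum fun j => ?_
          calc _ = x * (j * p j) * (coeff (N + k) (Y ^ (j - 1 + r) * spineGF p Y ^ k *
                geomSum (spineGF p Y)) * x ^ (N + k)) := by ring
            _ ≤ _ := by
              refine (mul_le_mul_right (ih (j - 1 + r)) _).trans_eq ?_
              ring
      _ = _ := by rw [ENNReal.tsum_mul_right, ENNReal.tsum_mul_left]; ring

end GaltonWatson

namespace PlaneTree

/-- The tree whose root has the children `a 0, …, a (j - 1)`. -/
def ofTuple {j : ℕ} (a : Fin j → PlaneTree) : PlaneTree := .node (List.ofFn a)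

/-- A tree is the same thing as the tuple of its children. -/
def tupleEquiv : (Σ j, Fin j → PlaneTree) ≃ PlaneTree :=
  List.equivSigmaTuple.symm.trans
    { toFun := .node, invFun := children, left_inv := fun _ => rfl, right_inv := fun ⟨_⟩ => rfl }

theorem tupleEquiv_apply {j : ℕ} (a : Fin j → PlaneTree) : tupleEquiv ⟨j, a⟩ = ofTuple a := rfl

theorem subtreeAt_ofTuple_cons {j : ℕ} (a : Fin j → PlaneTree) (i : ℕ) (q : List ℕ) :
    subtreeAt (ofTuple a) (i :: q) = if h : i < j then subtreeAt (a ⟨i, h⟩) q else none := by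
  rw [ofTuple, subtreeAt, List.getElem?_ofFn]
  split_ifs <;> rfl

theorem induction_ofTuple {motive : PlaneTree → Prop}
    (h : ∀ (j : ℕ) (a : Fin j → PlaneTree), (∀ i, motive (a i)) → motive (ofTuple a)) :
    ∀ t, motive t
  | .node ts => by
    have := h ts.length ts.get fun i => induction_ofTuple h (ts.get i)
    rwa [ofTuple, List.ofFn_get] at this
  decreasing_by
    have := List.sizeOf_lt_of_mem (List.get_mem ts i)
    simp only [node.sizeOf_spec]
    omega

theorem vertexSet_ofTuple {j : ℕ} (a : Fin j → PlaneTree) :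
    vertexSet (ofTuple a)
      = insert [] (⋃ i : Fin j, (fun q => (i : ℕ) :: q) '' vertexSet (a i)) := by
  ext q
  cases q with
  | nil => simp [vertexSet, subtreeAt]
  | cons i q =>
    simp only [vertexSet, mem_ofPred_eq, subtreeAt_ofTuple_cons, mem_insert_iff, mem_iUnion,
      mem_image, List.cons.injEq, reduceCtorEq, false_or]
    split_ifs with h
    · constructor
      · exact fun hq => ⟨⟨i, h⟩, q, hq, rfl, rfl⟩
      · rintro ⟨l, q', hq', rfl, rfl⟩
        exact hq'
    · simp only [Option.isSome_none, Bool.false_eq_true, false_iff]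
      rintro ⟨l, q', hq', rfl, rfl⟩
      exact h l.2

theorem finite_vertexSet (t : PlaneTree) : (vertexSet t).Finite := by
  induction t using induction_ofTuple with
  | h j a ih =>
    rw [vertexSet_ofTuple]
    exact (finite_iUnion fun i => (ih i).image _).insert _

@[to_additive]
theorem finprod_mem_vertexSet_ofTuple {M : Type*} [CommMonoid M] {j : ℕ} (a : Fin j → PlaneTree)
    (g : List ℕ → M) :
    ∏ᶠ v ∈ vertexSet (ofTuple a), g v = g [] * ∏ i, ∏ᶠ v ∈ vertexSet (a i), g ((i : ℕ) :: v) := by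
  have hfin (i : Fin j) := (finite_vertexSet (a i)).image (fun q => (i : ℕ) :: q)
  rw [vertexSet_ofTuple, finprod_mem_insert _ (by simp) (finite_iUnion hfin),
    finprod_mem_iUnion _ hfin, finprod_eq_prod_of_fintype]
  · congr 1
    refine Finset.prod_congr rfl fun i _ => ?_
    rw [finprod_mem_image]
    exact fun _ _ _ _ h => (List.cons.inj h).2
  · intro i l hil
    refine disjoint_left.2 ?_
    rintro _ ⟨q, _, rfl⟩ ⟨q', _, h⟩
    exact hil (Fin.ext (List.cons.inj h).1.symm)

theorem cast_ncard_sep_vertexSet (t : PlaneTree) (P : List ℕ → Prop) [DecidablePred P] :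
    (({v | v ∈ vertexSet t ∧ P v}.ncard : ℕ) : ℝ≥0∞)
      = ∑ᶠ v ∈ vertexSet t, if P v then 1 else 0 := by
  have hfin := finite_vertexSet t
  rw [finsum_mem_eq_finite_toFinset_sum _ hfin, Finset.sum_boole,
    ncard_eq_toFinset_card _ (hfin.subset fun v hv => hv.1)]
  congr 2
  ext v
  simp

theorem cast_size (t : PlaneTree) : (size t : ℝ≥0∞) = ∑ᶠ v ∈ vertexSet t, 1 := by
  have := cast_ncard_sep_vertexSet t fun _ => True
  simpa [size] using this

theorem size_ofTuple {j : ℕ} (a : Fin j → PlaneTree) :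
    size (ofTuple a) = 1 + ∑ i, size (a i) := by
  have : (size (ofTuple a) : ℝ≥0∞) = ((1 + ∑ i, size (a i) : ℕ) : ℝ≥0∞) := by
    push_cast
    simp only [cast_size]
    exact finsum_mem_vertexSet_ofTuple a _
  exact_mod_cast this

theorem gwProb_ofTuple (p : ℕ → ℝ≥0∞) {j : ℕ} (a : Fin j → PlaneTree) :
    gwProb p (ofTuple a) = p j * ∏ i, gwProb p (a i) := by
  rw [gwProb, finprod_mem_vertexSet_ofTuple]
  congr 1
  · simp [childCount, subtreeAt, ofTuple, children]
  · simp [childCount, subtreeAt_ofTuple_cons, gwProb]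

/-- The number of vertices at depth `k`. -/
noncomputable def levelCount (k : ℕ) (t : PlaneTree) : ℝ≥0∞ :=
  ∑ᶠ v ∈ vertexSet t, if v.length = k then 1 else 0

theorem levelCount_zero (t : PlaneTree) : levelCount 0 t = 1 := by
  induction t using induction_ofTuple with
  | h j a ih => simp [levelCount, finsum_mem_vertexSet_ofTuple]

theorem levelCount_succ_ofTuple (k : ℕ) {j : ℕ} (a : Fin j → PlaneTree) :
    levelCount (k + 1) (ofTuple a) = ∑ i, levelCount k (a i) := by
  simp [levelCount, finsum_mem_vertexSet_ofTuple]

/-- The number of ordered pairs of vertices at distance `k`. -/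
noncomputable def distCount (k : ℕ) (t : PlaneTree) : ℝ≥0∞ :=
  ∑ᶠ v ∈ vertexSet t, (rerootedZ t v k : ℝ≥0∞)

theorem distCount_eq (k : ℕ) (t : PlaneTree) :
    distCount k t = ∑ᶠ v ∈ vertexSet t, ∑ᶠ w ∈ vertexSet t, if treeDist v w = k then 1 else 0 := by
  simp only [distCount, rerootedZ, cast_ncard_sep_vertexSet]

theorem treeDist_cons_nil (i : ℕ) (v : List ℕ) : treeDist (i :: v) [] = v.length + 1 := by
  simp [treeDist, dUp, lca]

theorem treeDist_nil_cons (i : ℕ) (v : List ℕ) : treeDist [] (i :: v) = v.length + 1 := by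
  simp [treeDist, dUp, lca]

theorem treeDist_cons_cons_self (i : ℕ) (v w : List ℕ) :
    treeDist (i :: v) (i :: w) = treeDist v w := by
  simp [treeDist, dUp, lca]

theorem treeDist_cons_cons_of_ne {i l : ℕ} (h : i ≠ l) (v w : List ℕ) :
    treeDist (i :: v) (l :: w) = v.length + w.length + 2 := by
  simp [treeDist, dUp, lca, h, h.symm]
  omega

theorem finsum_finsum_length_add (k : ℕ) (t t' : PlaneTree) :
    (∑ᶠ v ∈ vertexSet t, ∑ᶠ w ∈ vertexSet t', if v.length + w.length = k then (1 : ℝ≥0∞) else 0)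
      = ∑ x ∈ Finset.HasAntidiagonal.antidiagonal k, levelCount x.1 t * levelCount x.2 t' := by
  have h := finite_vertexSet t
  have h' := finite_vertexSet t'
  have key (b c : ℕ) : (if b + c = k then (1 : ℝ≥0∞) else 0)
      = ∑ x ∈ Finset.HasAntidiagonal.antidiagonal k,
        (if b = x.1 then 1 else 0) * (if c = x.2 then 1 else 0) := by
    calc _ = if (b, c) ∈ Finset.HasAntidiagonal.antidiagonal k then (1 : ℝ≥0∞) else 0 := by simp
      _ = ∑ x ∈ Finset.HasAntidiagonal.antidiagonal k, if (b, c) = x then 1 else 0 := by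
        rw [Finset.sum_ite_eq]
      _ = _ := by
        refine Finset.sum_congr rfl fun x _ => ?_
        rw [ite_zero_mul_ite_zero, one_mul]
        simp only [Prod.ext_iff]
  simp only [levelCount, finsum_mem_eq_finite_toFinset_sum _ h,
    finsum_mem_eq_finite_toFinset_sum _ h', Finset.sum_mul_sum, key]
  conv_rhs => rw [Finset.sum_comm]
  refine Finset.sum_congr rfl fun v _ => ?_
  rw [Finset.sum_comm]

theorem distCount_succ_ofTuple (k : ℕ) {j : ℕ} (a : Fin j → PlaneTree) :
    distCount (k + 1) (ofTuple a)
      = ∑ i, levelCount k (a i) + ∑ i, levelCount k (a i) + ∑ i, distCount (k + 1) (a i)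
        + ∑ i, ∑ l, if i = l then 0 else ∑ᶠ v ∈ vertexSet (a i), ∑ᶠ w ∈ vertexSet (a l),
            if v.length + w.length + 1 = k then 1 else 0 := by
  have key (i l : Fin j) : (∑ᶠ v ∈ vertexSet (a i), ∑ᶠ w ∈ vertexSet (a l),
        if treeDist ((i : ℕ) :: v) ((l : ℕ) :: w) = k + 1 then (1 : ℝ≥0∞) else 0)
      = (if i = l then distCount (k + 1) (a i) else 0)
        + if i = l then 0 else ∑ᶠ v ∈ vertexSet (a i), ∑ᶠ w ∈ vertexSet (a l),
            if v.length + w.length + 1 = k then 1 else 0 := by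
    split_ifs with h
    · subst h
      simp [treeDist_cons_cons_self, distCount_eq]
    · have h' : (i : ℕ) ≠ l := fun e => h (Fin.ext e)
      simp only [treeDist_cons_cons_of_ne h', zero_add,
        show ∀ b c : ℕ, b + c + 2 = k + 1 ↔ b + c + 1 = k from fun b c => by omega]
  have hfin (i : Fin j) := finite_vertexSet (a i)
  have hsum (i : Fin j) : (∑ᶠ v ∈ vertexSet (a i), ∑ l, ∑ᶠ w ∈ vertexSet (a l),
        if treeDist ((i : ℕ) :: v) ((l : ℕ) :: w) = k + 1 then (1 : ℝ≥0∞) else 0)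
      = ∑ l, ∑ᶠ v ∈ vertexSet (a i), ∑ᶠ w ∈ vertexSet (a l),
        if treeDist ((i : ℕ) :: v) ((l : ℕ) :: w) = k + 1 then (1 : ℝ≥0∞) else 0 := by
    simp only [finsum_mem_eq_finite_toFinset_sum _ (hfin i)]
    exact Finset.sum_comm
  rw [distCount_eq]
  simp only [finsum_mem_vertexSet_ofTuple]
  simp only [finsum_mem_add_distrib (hfin _), hsum, key, Finset.sum_add_distrib,
    treeDist_nil_cons, treeDist_cons_nil, Finset.sum_ite_eq, Finset.mem_univ, if_true,
    Nat.add_right_cancel_iff, levelCount]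
  simp [treeDist, dUp, lca, add_assoc]

end PlaneTree

namespace GaltonWatson
open PowerSeries PlaneTree

/-- The generating function of the weights `f` with respect to the size `s`. -/
noncomputable def sizeGF {α : Type*} (s : α → ℕ) (f : α → ℝ≥0∞) : ℝ≥0∞⟦X⟧ :=
  .mk fun n => ∑' a, if s a = n then f a else 0

section sizeGF

variable {α β : Type*} (s : α → ℕ)

theorem sizeGF_add (f g : α → ℝ≥0∞) : sizeGF s (fun a => f a + g a) = sizeGF s f + sizeGF s g := by
  ext n
  simp only [sizeGF, map_add, coeff_mk, ← ENNReal.tsum_add]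
  exact tsum_congr fun a => by split_ifs <;> simp

theorem sizeGF_sum {ι : Type*} (u : Finset ι) (f : ι → α → ℝ≥0∞) :
    sizeGF s (fun a => ∑ i ∈ u, f i a) = ∑ i ∈ u, sizeGF s (f i) := by
  classical
  induction u using Finset.induction_on with
  | empty => ext n; simp [sizeGF]
  | insert i u hi ih => simp only [Finset.sum_insert hi, sizeGF_add, ih]

theorem sizeGF_equiv (e : β ≃ α) (f : α → ℝ≥0∞) :
    sizeGF (fun b => s (e b)) (fun b => f (e b)) = sizeGF s f := by
  ext n
  simpa only [sizeGF, coeff_mk] using e.tsum_eq fun a => if s a = n then f a else 0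

theorem sizeGF_mul (s' : β → ℕ) (f : α → ℝ≥0∞) (g : β → ℝ≥0∞) :
    sizeGF (fun x : α × β => s x.1 + s' x.2) (fun x => f x.1 * g x.2)
      = sizeGF s f * sizeGF s' g := by
  ext n
  simp only [sizeGF, coeff_mul, coeff_mk, ← ENNReal.tsum_mul_left, ← ENNReal.tsum_mul_right]
  rw [ENNReal.tsum_prod', ← Summable.tsum_finsetSum fun _ _ => ENNReal.summable]
  rw [ENNReal.tsum_comm]
  refine tsum_congr fun b => ?_
  rw [← Summable.tsum_finsetSum fun _ _ => ENNReal.summable]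
  refine tsum_congr fun a => ?_
  calc _ = if (s a, s' b) ∈ Finset.HasAntidiagonal.antidiagonal n then f a * g b else 0 := by simp
    _ = ∑ x ∈ Finset.HasAntidiagonal.antidiagonal n, if (s a, s' b) = x then f a * g b else 0 := by
      rw [Finset.sum_ite_eq]
    _ = _ := by
      refine Finset.sum_congr rfl fun x _ => ?_
      rw [ite_zero_mul_ite_zero]
      simp only [Prod.ext_iff]

theorem sizeGF_pi {j : ℕ} (F : Fin j → α → ℝ≥0∞) :
    sizeGF (fun a : Fin j → α => ∑ i, s (a i)) (fun a => ∏ i, F i (a i))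
      = ∏ i, sizeGF s (F i) := by
  induction j with
  | zero =>
    ext n
    simp [sizeGF, coeff_one, eq_comm]
  | succ j ih =>
    rw [← sizeGF_equiv _ (Fin.consEquiv fun _ => α), Fin.prod_univ_succ, ← ih, ← sizeGF_mul]
    simp [Fin.consEquiv, Fin.sum_univ_succ, Fin.prod_univ_succ]

end sizeGF

/-- The generating function of the functional `f` of the Galton–Watson tree. -/
noncomputable def treeGF (p : ℕ → ℝ≥0∞) (f : PlaneTree → ℝ≥0∞) : ℝ≥0∞⟦X⟧ :=
  sizeGF size fun t => gwProb p t * f t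

/-- The generating function of a functional `F` of the tuple of children of the root. -/
noncomputable def tupleGF (p : ℕ → ℝ≥0∞) (F : ∀ j, (Fin j → PlaneTree) → ℝ≥0∞) : ℝ≥0∞⟦X⟧ :=
  X * .mk fun n => ∑' j, p j * coeff n (sizeGF (fun a : Fin j → PlaneTree => ∑ i, size (a i))
    fun a => (∏ i, gwProb p (a i)) * F j a)

variable {p : ℕ → ℝ≥0∞}

theorem treeGF_eq_tupleGF {f : PlaneTree → ℝ≥0∞} {F : ∀ j, (Fin j → PlaneTree) → ℝ≥0∞}
    (h : ∀ j (a : Fin j → PlaneTree), f (ofTuple a) = F j a) : treeGF p f = tupleGF p F := by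
  rw [treeGF, ← sizeGF_equiv _ tupleEquiv]
  ext n
  simp only [sizeGF, tupleGF, coeff_mk]
  rw [ENNReal.tsum_sigma']
  simp only [tupleEquiv_apply, size_ofTuple, gwProb_ofTuple, h]
  cases n with
  | zero => simp
  | succ n =>
    simp only [coeff_succ_X_mul, coeff_mk, ← ENNReal.tsum_mul_left]
    refine tsum_congr fun j => tsum_congr fun a => ?_
    simp only [add_comm 1, Nat.add_right_cancel_iff, mul_ite, mul_zero, mul_assoc]

theorem tupleGF_add (F G : ∀ j, (Fin j → PlaneTree) → ℝ≥0∞) :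
    tupleGF p (fun j a => F j a + G j a) = tupleGF p F + tupleGF p G := by
  rw [tupleGF, tupleGF, tupleGF, ← mul_add]
  congr 1
  ext n
  simp only [mul_add, sizeGF_add, map_add, coeff_mk, ENNReal.tsum_add]

theorem tupleGF_finsetSum {ι : Type*} (u : Finset ι) (F : ι → ∀ j, (Fin j → PlaneTree) → ℝ≥0∞) :
    tupleGF p (fun j a => ∑ i ∈ u, F i j a) = ∑ i ∈ u, tupleGF p (F i) := by
  classical
  induction u using Finset.induction_on with
  | empty =>
    simp only [Finset.sum_empty, tupleGF, sizeGF, mul_zero, ite_self, tsum_zero, coeff_mk]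
    exact mul_zero _
  | insert i u hi ih => simp only [Finset.sum_insert hi, tupleGF_add, ih]

theorem tupleGF_one :
    tupleGF p (fun _ _ => 1) = X * powSum p id (treeGF p fun _ => 1) := by
  simp only [tupleGF, mul_one, sizeGF_pi, treeGF, powSum, id, Finset.prod_const, Finset.card_univ,
    Fintype.card_fin]

theorem treeGF_one_eq :
    treeGF p (fun _ => 1) = X * powSum p id (treeGF p fun _ => 1) := by
  rw [← tupleGF_one]
  exact treeGF_eq_tupleGF fun _ _ => rfl

theorem prod_ite_eq_mul_pow {M : Type*} [CommMonoid M] {j : ℕ} (i : Fin j) (A B : M) :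
    (∏ l, if l = i then A else B) = A * B ^ (j - 1) := by
  rw [← Finset.mul_prod_erase _ _ (Finset.mem_univ i), if_pos rfl,
    Finset.prod_congr rfl fun l hl => if_neg (Finset.ne_of_mem_erase hl)]
  simp

theorem prod_ite_ite_eq_mul_pow {M : Type*} [CommMonoid M] {j : ℕ} {i i' : Fin j} (h : i ≠ i')
    (A A' B : M) :
    (∏ l, if l = i then A else if l = i' then A' else B) = A * A' * B ^ (j - 2) := by
  have h' : i' ∈ Finset.univ.erase i := by simp [h.symm]
  rw [← Finset.mul_prod_erase _ _ (Finset.mem_univ i), if_pos rfl,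
    ← Finset.mul_prod_erase _ _ h', if_neg h.symm, if_pos rfl, ← mul_assoc,
    Finset.prod_congr rfl fun l hl => ?_]
  · rw [Finset.prod_const, Finset.card_erase_of_mem h', Finset.card_erase_of_mem (Finset.mem_univ _),
      Finset.card_univ, Fintype.card_fin]
    rfl
  · rw [if_neg, if_neg (Finset.ne_of_mem_erase hl)]
    exact Finset.ne_of_mem_erase (Finset.mem_of_mem_erase hl)

theorem tupleGF_sum (f : PlaneTree → ℝ≥0∞) :
    tupleGF p (fun _ a => ∑ i, f (a i)) = spineGF p (treeGF p fun _ => 1) * treeGF p f := by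
  have key (j : ℕ) (i : Fin j) : sizeGF (fun a : Fin j → PlaneTree => ∑ i, size (a i))
      (fun a => (∏ l, gwProb p (a l)) * f (a i))
      = (treeGF p fun _ => 1) ^ (j - 1) * treeGF p f := by
    rw [mul_comm, ← prod_ite_eq_mul_pow i]
    simp only [treeGF, ← apply_ite (sizeGF size), ← sizeGF_pi]
    congr 1 with a
    have (l : Fin j) : (if l = i then (fun t => gwProb p t * f t) else fun t => gwProb p t * 1) (a l)
      = gwProb p (a l) * if l = i then f (a l) else 1 := by split_ifs <;> rfl
    simp only [this, Finset.prod_mul_distrib, Finset.prod_ite_eq', Finset.mem_univ, if_true]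
  rw [tupleGF, spineGF, mul_assoc]
  congr 1
  ext n
  rw [coeff_powSum_mul, coeff_mk]
  refine tsum_congr fun j => ?_
  simp only [Finset.mul_sum, sizeGF_sum, key, Finset.sum_const, Finset.card_univ, Fintype.card_fin,
    map_nsmul]
  rw [nsmul_eq_mul]
  ring

theorem tupleGF_sum_sum (f g : PlaneTree → ℝ≥0∞) :
    tupleGF p (fun _ a => ∑ i, ∑ l, if i = l then 0 else f (a i) * g (a l))
      = X * (powSum (fun j => ((j * (j - 1) : ℕ) : ℝ≥0∞) * p j) (· - 2) (treeGF p fun _ => 1)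
        * (treeGF p f * treeGF p g)) := by
  have key (j : ℕ) (i i' : Fin j) (h : i ≠ i') :
      sizeGF (fun a : Fin j → PlaneTree => ∑ i, size (a i))
        (fun a => (∏ l, gwProb p (a l)) * (f (a i) * g (a i')))
      = (treeGF p fun _ => 1) ^ (j - 2) * (treeGF p f * treeGF p g) := by
    rw [mul_comm, ← prod_ite_ite_eq_mul_pow h]
    simp only [treeGF, ← apply_ite (sizeGF size), ← sizeGF_pi]
    congr 1 with a
    have (l : Fin j) : (if l = i then (fun t => gwProb p t * f t) else
        if l = i' then (fun t => gwProb p t * g t) else fun t => gwProb p t * 1) (a l)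
      = gwProb p (a l) * if l = i then f (a l) else if l = i' then g (a l) else 1 := by
        split_ifs <;> rfl
    simp only [this, Finset.prod_mul_distrib]
    congr 1
    have := prod_ite_ite_eq_mul_pow h (f (a i)) (g (a i')) 1
    rw [one_pow, mul_one] at this
    rw [← this]
    refine Finset.prod_congr rfl fun l _ => ?_
    split_ifs with h1 h2 <;> simp [*]
  have hsum (j : ℕ) : (sizeGF (fun a : Fin j → PlaneTree => ∑ i, size (a i)) fun a =>
      (∏ l, gwProb p (a l)) * ∑ i, ∑ l, if i = l then 0 else f (a i) * g (a l))
      = (j * (j - 1)) • ((treeGF p fun _ => 1) ^ (j - 2) * (treeGF p f * treeGF p g)) := by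
    simp only [Finset.mul_sum, sizeGF_sum]
    have (i l : Fin j) : (sizeGF (fun a : Fin j → PlaneTree => ∑ i, size (a i)) fun a =>
        (∏ l, gwProb p (a l)) * if i = l then 0 else f (a i) * g (a l))
        = if i ≠ l then (treeGF p fun _ => 1) ^ (j - 2) * (treeGF p f * treeGF p g) else 0 := by
      by_cases h : i = l
      · simp only [h, if_true, mul_zero, ne_eq, not_true, if_false]
        ext n
        simp [sizeGF]
      · simp only [h, if_false, ne_eq, not_false_iff, if_true, key j i l h]
    simp only [this]
    have hc (i : Fin j) : (Finset.univ.filter fun l => i ≠ l).card = j - 1 := by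
      rw [Finset.filter_ne, Finset.card_erase_of_mem (Finset.mem_univ _), Finset.card_univ,
        Fintype.card_fin]
    simp only [← Finset.sum_filter, Finset.sum_const, hc, Finset.card_univ, Fintype.card_fin,
      mul_smul]
  rw [tupleGF]
  congr 1
  ext n
  rw [coeff_powSum_mul, coeff_mk]
  refine tsum_congr fun j => ?_
  rw [hsum, map_nsmul, nsmul_eq_mul]
  ring

end GaltonWatson

namespace GaltonWatson
open PowerSeries PlaneTree

variable {p : ℕ → ℝ≥0∞}

theorem treeGF_levelCount (k : ℕ) :
    treeGF p (levelCount k) = spineGF p (treeGF p fun _ => 1) ^ k * treeGF p fun _ => 1 := by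
  induction k with
  | zero => rw [pow_zero, one_mul, funext levelCount_zero]
  | succ k ih =>
    rw [treeGF_eq_tupleGF fun _ => levelCount_succ_ofTuple k, tupleGF_sum, ih]
    ring

theorem natCast_mul_probSize (n : ℕ) :
    n * probSize p n = coeff n (X * offspringGF p ^ n) := by
  have h : treeGF p (fun t => (size t : ℝ≥0∞)) = (treeGF p fun _ => 1)
      + spineGF p (treeGF p fun _ => 1) * treeGF p (fun t => (size t : ℝ≥0∞)) := by
    rw [← tupleGF_sum, treeGF_eq_tupleGF (f := fun t => (size t : ℝ≥0∞))
      (F := fun _ a => 1 + ∑ i, (size (a i) : ℝ≥0∞)), tupleGF_add, tupleGF_one, ← treeGF_one_eq]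
    intro j a
    rw [size_ofTuple]
    push_cast
    rfl
  have h' := coeff_pow_mul_geomSum (p := p) treeGF_one_eq 1 n
  rw [pow_one, ← eq_mul_geomSum (W := spineGF p _) rfl h, pow_one] at h'
  rw [← h', treeGF, sizeGF, coeff_mk, probSize, ← ENNReal.tsum_mul_left]
  refine tsum_congr fun t => ?_
  split_ifs with ht
  · rw [ht, mul_comm]
  · simp

theorem treeGF_distCount_succ_eq (k : ℕ) :
    treeGF p (distCount (k + 1))
      = (2 * (spineGF p (treeGF p fun _ => 1) ^ (k + 1) * treeGF p fun _ => 1)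
        + tupleGF p fun _ a => ∑ i, ∑ l, if i = l then 0 else
            ∑ᶠ v ∈ vertexSet (a i), ∑ᶠ w ∈ vertexSet (a l),
              if v.length + w.length + 1 = k then 1 else 0)
        * geomSum (spineGF p (treeGF p fun _ => 1)) := by
  refine eq_mul_geomSum rfl ?_
  rw [← tupleGF_sum]
  rw [treeGF_eq_tupleGF fun _ => distCount_succ_ofTuple k]
  rw [tupleGF_add, tupleGF_add, tupleGF_add, tupleGF_sum, treeGF_levelCount, tupleGF_sum]
  ring

theorem tupleGF_pairs (k : ℕ) :
    (tupleGF p fun _ a => ∑ i, ∑ l, if i = l then 0 else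
        ∑ᶠ v ∈ vertexSet (a i), ∑ᶠ w ∈ vertexSet (a l),
          if v.length + w.length + 1 = k then 1 else 0)
      = (k : ℝ≥0∞⟦X⟧) * (X * (powSum (fun j => ((j * (j - 1) : ℕ) : ℝ≥0∞) * p j) (· - 2) (treeGF p fun _ => 1)
        * (spineGF p (treeGF p fun _ => 1) ^ (k - 1) * (treeGF p fun _ => 1) ^ 2))) := by
  cases k with
  | zero =>
    have := tupleGF_finsetSum (p := p) (∅ : Finset ℕ) fun _ _ _ => 0
    simp only [Finset.sum_empty] at this
    simp [this]
  | succ k =>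
    simp only [Nat.add_right_cancel_iff, finsum_finsum_length_add]
    have (j : ℕ) (a : Fin j → PlaneTree) : (∑ i, ∑ l, if i = l then 0 else
        ∑ x ∈ Finset.HasAntidiagonal.antidiagonal k, levelCount x.1 (a i) * levelCount x.2 (a l))
        = ∑ x ∈ Finset.HasAntidiagonal.antidiagonal k, ∑ i, ∑ l,
          if i = l then 0 else levelCount x.1 (a i) * levelCount x.2 (a l) := by
      conv_rhs => rw [Finset.sum_comm]
      refine Finset.sum_congr rfl fun i _ => ?_
      conv_rhs => rw [Finset.sum_comm]
      refine Finset.sum_congr rfl fun l _ => ?_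
      split_ifs <;> simp
    simp only [this, tupleGF_finsetSum, tupleGF_sum_sum, treeGF_levelCount]
    rw [Finset.sum_congr rfl fun x hx => ?_, Finset.sum_const, Finset.Nat.card_antidiagonal,
      nsmul_eq_mul]
    rw [Nat.add_sub_cancel, ← Finset.HasAntidiagonal.mem_antidiagonal.1 hx]
    ring

/-- A bound on the expected number of pairs at a given distance. -/
theorem coeff_treeGF_distCount_succ_le {n : ℕ} {u : ℝ≥0∞}
    (hu : ∀ r k m, n ≤ m → m ≤ n + 1 → coeff m ((treeGF p fun _ => 1) ^ r *
      spineGF p (treeGF p fun _ => 1) ^ k * geomSum (spineGF p (treeGF p fun _ => 1))) ≤ u)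
    (k : ℕ) :
    coeff (n + 1) (treeGF p (distCount (k + 1)))
      ≤ 2 * u + k * ((∑' j : ℕ, ((j * (j - 1) : ℕ) : ℝ≥0∞) * p j) * u) := by
  rw [treeGF_distCount_succ_eq, add_mul, map_add, tupleGF_pairs]
  gcongr
  · rw [show (2 : ℝ≥0∞⟦X⟧) = C 2 from (map_ofNat C 2).symm, mul_assoc, coeff_C_mul]
    gcongr
    have := hu 1 (k + 1) (n + 1) (by simp) le_rfl
    rwa [pow_one, mul_comm (treeGF p _) (_ ^ _)] at this
  · rw [show (k : ℝ≥0∞⟦X⟧) = C (k : ℝ≥0∞) by simp, mul_assoc, coeff_C_mul]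
    gcongr
    rw [mul_assoc, coeff_succ_X_mul, mul_assoc, coeff_powSum_mul, ← ENNReal.tsum_mul_right]
    refine ENNReal.tsum_le_tsum fun j => ?_
    gcongr
    refine le_of_eq_of_le ?_ (hu (j - 2 + 2) (k - 1) n le_rfl (by simp))
    rw [pow_add]
    ring_nf

end GaltonWatson

namespace GaltonWatson
open PowerSeries PlaneTree MeasureTheory
open scoped Topology

/-- `q` is a critical offspring distribution with variance `s > 0`. -/
structure IsCritical (q : ℕ → ℝ) (s : ℝ) : Prop where
  nonneg : ∀ j, 0 ≤ q j
  hasSum : HasSum q 1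
  hasSum_mean : HasSum (fun j : ℕ => q j * ((j : ℝ) - 1)) 0
  hasSum_var : HasSum (fun j : ℕ => q j * ((j : ℝ) - 1) ^ 2) s
  var_pos : 0 < s

/-- The characteristic function of the offspring distribution. -/
noncomputable def offspringChar (q : ℕ → ℝ) (θ : ℝ) : ℂ :=
  ∑' j, (q j : ℂ) * Complex.exp (θ * Complex.I) ^ j

/-- The probability that `N` independent variables with distribution `q` have sum `m`. -/
noncomputable def walkProb (q : ℕ → ℝ) (N m : ℕ) : ℝ := coeff m (PowerSeries.mk q ^ N)

section

variable {q : ℕ → ℝ} {s : ℝ}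

theorem walkProb_succ (q : ℕ → ℝ) (N m : ℕ) : walkProb q (N + 1) m
    = ∑ x ∈ Finset.HasAntidiagonal.antidiagonal m, walkProb q N x.1 * q x.2 := by
  simp [walkProb, pow_succ, coeff_mul]

theorem walkProb_nonneg (hq : ∀ j, 0 ≤ q j) (N m : ℕ) : 0 ≤ walkProb q N m := by
  induction N generalizing m with
  | zero => rw [walkProb, pow_zero, coeff_one]; positivity
  | succ N ih =>
    rw [walkProb_succ]
    exact Finset.sum_nonneg fun x _ => mul_nonneg (ih _) (hq _)

theorem dvd_of_walkProb_ne_zero {d : ℕ} (hd : ∀ j, q j ≠ 0 → d ∣ j) {N m : ℕ}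
    (h : walkProb q N m ≠ 0) : d ∣ m := by
  induction N generalizing m with
  | zero =>
    rw [walkProb, pow_zero, coeff_one] at h
    have : m = 0 := by by_contra hm; simp [hm] at h
    simp [this]
  | succ N ih =>
    rw [walkProb_succ] at h
    obtain ⟨x, hx, hne⟩ := Finset.exists_ne_zero_of_sum_ne_zero h
    rw [← Finset.HasAntidiagonal.mem_antidiagonal.1 hx]
    exact dvd_add (ih (left_ne_zero_of_mul hne)) (hd _ (right_ne_zero_of_mul hne))

theorem summable_norm_walkProb_mul_pow (hs : Summable q) (hq : ∀ j, 0 ≤ q j) {z : ℂ}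
    (hz : ‖z‖ = 1) (N : ℕ) :
    (Summable fun m => ‖(walkProb q N m : ℂ) * z ^ m‖) ∧
      ∑' m, (walkProb q N m : ℂ) * z ^ m = (∑' j, (q j : ℂ) * z ^ j) ^ N := by
  have hs' : Summable fun j => ‖(q j : ℂ) * z ^ j‖ := by
    simpa [hz, abs_of_nonneg (hq _)] using hs
  induction N with
  | zero =>
    have h (m : ℕ) : (walkProb q 0 m : ℂ) * z ^ m = if m = 0 then 1 else 0 := by
      rw [walkProb, pow_zero, coeff_one]
      split_ifs with hm <;> simp [hm]
    simp only [h, tsum_ite_eq, pow_zero, and_true]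
    exact summable_of_ne_finset_zero (s := {0}) fun m hm => by simp_all
  | succ N ih =>
    have h (m : ℕ) : (walkProb q (N + 1) m : ℂ) * z ^ m
        = ∑ x ∈ Finset.HasAntidiagonal.antidiagonal m,
          ((walkProb q N x.1 : ℂ) * z ^ x.1) * ((q x.2 : ℂ) * z ^ x.2) := by
      rw [walkProb_succ]
      push_cast
      rw [Finset.sum_mul]
      refine Finset.sum_congr rfl fun x hx => ?_
      rw [← Finset.HasAntidiagonal.mem_antidiagonal.1 hx]
      ring
    simp only [h]
    obtain ⟨ih1, ih2⟩ := ih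
    rw [pow_succ, ← ih2]
    have h1 := summable_norm_sum_mul_antidiagonal_of_summable_norm ih1 hs'
    have h2 := tsum_mul_tsum_eq_tsum_sum_antidiagonal_of_summable_norm ih1 hs'
    exact ⟨h1, h2.symm⟩

theorem summable_walkProb (hs : Summable q) (hq : ∀ j, 0 ≤ q j) (N : ℕ) :
    Summable (walkProb q N) := by
  simpa [abs_of_nonneg (walkProb_nonneg hq N _)] using
    (summable_norm_walkProb_mul_pow hs hq (z := 1) (by simp) N).1

theorem IsCritical.exists_two_le (h : IsCritical q s) : ∃ j, 2 ≤ j ∧ 0 < q j := by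
  by_contra! hc
  have h0 (j : ℕ) : 0 ≤ -(q j * ((j : ℝ) - 1)) := by
    rcases le_or_gt 2 j with hj | hj
    · simp [le_antisymm (hc j hj) (h.nonneg j)]
    · have : (j : ℝ) ≤ 1 := by exact_mod_cast Nat.lt_succ_iff.1 hj
      nlinarith [h.nonneg j]
  have h1 := (hasSum_zero_iff_of_nonneg h0).1 (by simpa using h.hasSum_mean.neg)
  have h2 : (fun j : ℕ => q j * ((j : ℝ) - 1) ^ 2) = 0 := by
    ext j
    have := congrFun h1 j
    simp only [Pi.zero_apply, neg_eq_zero] at this ⊢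
    rw [pow_two, ← mul_assoc, this, zero_mul]
  exact h.var_pos.ne (HasSum.unique (h2 ▸ hasSum_zero) h.hasSum_var)

theorem IsCritical.zero_pos (h : IsCritical q s) : 0 < q 0 := by
  by_contra! hc
  have h0 (j : ℕ) : 0 ≤ q j * ((j : ℝ) - 1) := by
    rcases Nat.eq_zero_or_pos j with rfl | hj
    · simp [le_antisymm hc (h.nonneg 0)]
    · have : (1 : ℝ) ≤ j := by exact_mod_cast hj
      exact mul_nonneg (h.nonneg j) (by linarith)
  have h1 := (hasSum_zero_iff_of_nonneg h0).1 h.hasSum_mean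
  have h2 : (fun j : ℕ => q j * ((j : ℝ) - 1) ^ 2) = 0 := by
    ext j
    have := congrFun h1 j
    simp only [Pi.zero_apply] at this ⊢
    rw [pow_two, ← mul_assoc, this, zero_mul]
  exact h.var_pos.ne (HasSum.unique (h2 ▸ hasSum_zero) h.hasSum_var)

theorem summable_offspringChar (hs : Summable q) (hq : ∀ j, 0 ≤ q j) (θ : ℝ) :
    Summable fun j => (q j : ℂ) * Complex.exp (θ * Complex.I) ^ j := by
  refine Summable.of_norm ?_
  simpa [abs_of_nonneg (hq _)] using hs

theorem re_exp_pow (θ : ℝ) (j : ℕ) : (Complex.exp (θ * Complex.I) ^ j).re = Real.cos (j * θ) := by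
  rw [← Complex.exp_nat_mul, ← mul_assoc]
  exact_mod_cast Complex.exp_ofReal_mul_I_re (j * θ)

theorem IsCritical.hasSum_one_sub_re (h : IsCritical q s) (θ : ℝ) :
    HasSum (fun j : ℕ => q j * (1 - Real.cos (j * θ))) (1 - (offspringChar q θ).re) := by
  have h1 := Complex.hasSum_re (summable_offspringChar h.hasSum.summable h.nonneg θ).hasSum
  simp only [Complex.re_ofReal_mul, re_exp_pow] at h1
  simpa [mul_sub, offspringChar] using h.hasSum.sub h1

theorem IsCritical.normSq_offspringChar_le (h : IsCritical q s) (θ : ℝ) :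
    ‖offspringChar q θ‖ ^ 2 ≤ 1 - 2 * q 0 * (1 - (offspringChar q θ).re) := by
  have hsum := summable_offspringChar h.hasSum.summable h.nonneg θ
  have h1 : offspringChar q θ = q 0 + ∑' j, (q (j + 1) : ℂ) * Complex.exp (θ * Complex.I) ^ (j + 1) := by
    rw [offspringChar, hsum.tsum_eq_zero_add]
    simp
  set R := ∑' j, (q (j + 1) : ℂ) * Complex.exp (θ * Complex.I) ^ (j + 1) with hR
  have h2 : ‖R‖ ≤ 1 - q 0 := by
    have h3 : HasSum (fun j => q (j + 1)) (1 - q 0) := by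
      simpa using (hasSum_nat_add_iff' 1).2 h.hasSum
    refine tsum_of_norm_bounded h3 fun j => ?_
    simp [abs_of_nonneg (h.nonneg _)]
  have h3 : (offspringChar q θ).re = q 0 + R.re := by rw [h1]; simp
  have h4 : ‖offspringChar q θ‖ ^ 2 = q 0 ^ 2 + 2 * q 0 * R.re + ‖R‖ ^ 2 := by
    rw [h1, ← Complex.normSq_eq_norm_sq, ← Complex.normSq_eq_norm_sq, Complex.normSq_apply,
      Complex.normSq_apply]
    simp
    ring
  rw [h4, h3]
  nlinarith [norm_nonneg R, h.nonneg 0]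

theorem one_sub_cos_add_le (x y : ℝ) :
    1 - Real.cos (x + y) ≤ 2 * (1 - Real.cos x) + 2 * (1 - Real.cos y) := by
  rw [Real.cos_add]
  nlinarith [Real.sin_sq_add_cos_sq x, Real.sin_sq_add_cos_sq y, sq_nonneg (Real.sin x - Real.sin y),
    sq_nonneg (Real.cos x + Real.cos y - 2), sq_nonneg (Real.sin x + Real.sin y), sq_nonneg (Real.cos x - Real.cos y)]

/-- The subgroup generated by the support of `q`, in quantitative form. -/
theorem IsCritical.exists_span (h : IsCritical q s) :
    ∃ d : ℕ, 0 < d ∧ (∀ j, q j ≠ 0 → d ∣ j) ∧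
      ∃ A : ℝ, 0 < A ∧ ∀ θ : ℝ, 1 - Real.cos (d * θ) ≤ A * (1 - (offspringChar q θ).re) := by
  have hnn (θ : ℝ) : 0 ≤ 1 - (offspringChar q θ).re :=
    (h.hasSum_one_sub_re θ).nonneg fun j => mul_nonneg (h.nonneg j) (by linarith [Real.cos_le_one (j * θ)])
  let G : AddSubgroup ℤ :=
    { carrier := {m | ∃ A : ℝ, 0 ≤ A ∧
        ∀ θ : ℝ, 1 - Real.cos (m * θ) ≤ A * (1 - (offspringChar q θ).re)}
      zero_mem' := ⟨0, le_rfl, by simp⟩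
      add_mem' := by
        rintro a b ⟨A, hA0, hA⟩ ⟨B, hB0, hB⟩
        refine ⟨2 * A + 2 * B, by positivity, fun θ => ?_⟩
        push_cast
        rw [add_mul]
        linarith [one_sub_cos_add_le (a * θ) (b * θ), hA θ, hB θ]
      neg_mem' := by
        rintro a ⟨A, hA0, hA⟩
        refine ⟨A, hA0, fun θ => ?_⟩
        push_cast
        rw [neg_mul, Real.cos_neg]
        exact hA θ }
  have hG (j : ℕ) (hj : q j ≠ 0) : (j : ℤ) ∈ G := by
    refine ⟨(q j)⁻¹, inv_nonneg.2 (h.nonneg j), fun θ => ?_⟩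
    rw [inv_mul_eq_div, le_div_iff₀ ((h.nonneg j).lt_of_ne' hj), mul_comm]
    exact le_hasSum (h.hasSum_one_sub_re θ) j fun i _ =>
      mul_nonneg (h.nonneg i) (by linarith [Real.cos_le_one (i * θ)])
  obtain ⟨a, ha⟩ := Int.subgroup_cyclic G
  have hdvd (j : ℕ) (hj : q j ≠ 0) : a.natAbs ∣ j := by
    have := hG j hj
    rw [ha, AddSubgroup.mem_closure_singleton] at this
    obtain ⟨m, hm⟩ := this
    rw [← Int.natCast_dvd_natCast, Int.natAbs_dvd]
    exact ⟨m, by rw [← hm, smul_eq_mul, mul_comm]⟩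
  obtain ⟨j, hj2, hj⟩ := h.exists_two_le
  have haG : (a.natAbs : ℤ) ∈ G := by
    have : a ∈ G := by rw [ha]; exact AddSubgroup.mem_closure_singleton_self a
    rcases Int.natAbs_eq a with e | e
    · rwa [← e]
    · rw [← G.neg_mem_iff, ← e]; exact this
  obtain ⟨A, hA0, hA⟩ := haG
  refine ⟨a.natAbs, ?_, hdvd, A + 1, by linarith, fun θ => ?_⟩
  · refine Nat.pos_of_ne_zero fun h0 => ?_
    have := hdvd j hj.ne'
    rw [h0, zero_dvd_iff] at this
    omega
  · refine (hA θ).trans ?_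
    have := hnn θ
    nlinarith

/-- Gaussian bound for the characteristic function on a fundamental domain. -/
theorem IsCritical.exists_norm_offspringChar_le (h : IsCritical q s) :
    ∃ d : ℕ, 0 < d ∧ (∀ j, q j ≠ 0 → d ∣ j) ∧ ∃ c : ℝ, 0 < c ∧
      ∀ θ : ℝ, |θ| ≤ Real.pi / d → ‖offspringChar q θ‖ ≤ Real.exp (-c * θ ^ 2) := by
  obtain ⟨d, hd, hdvd, A, hA, hle⟩ := h.exists_span
  have hd' : (0 : ℝ) < d := by exact_mod_cast hd
  have hq0 := h.zero_pos
  have hpi := Real.pi_pos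
  refine ⟨d, hd, hdvd, 2 * q 0 * d ^ 2 / (A * Real.pi ^ 2), by positivity, fun θ hθ => ?_⟩
  have h1 : |d * θ| ≤ Real.pi := by
    rw [abs_mul, abs_of_pos hd', mul_comm]
    exact (le_div_iff₀ hd').1 hθ
  have h2 : 2 / Real.pi ^ 2 * (d * θ) ^ 2 ≤ 1 - Real.cos (d * θ) := by
    linarith [Real.cos_le_one_sub_mul_cos_sq h1]
  have h3 : ‖offspringChar q θ‖ ^ 2
      ≤ Real.exp (-(2 * q 0 * d ^ 2 / (A * Real.pi ^ 2)) * θ ^ 2) ^ 2 := by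
    rw [← Real.exp_nat_mul]
    refine (h.normSq_offspringChar_le θ).trans (le_trans ?_ (Real.add_one_le_exp _))
    have h4 : 2 / Real.pi ^ 2 * (d * θ) ^ 2 / A ≤ 1 - (offspringChar q θ).re := by
      rw [div_le_iff₀ hA, mul_comm _ A]
      exact h2.trans (hle θ)
    have h5 := mul_le_mul_of_nonneg_left h4 (show 0 ≤ 2 * q 0 by positivity)
    have h6 : 2 * q 0 * (2 / Real.pi ^ 2 * (d * θ) ^ 2 / A)
        = 2 * (2 * q 0 * d ^ 2 / (A * Real.pi ^ 2) * θ ^ 2) := by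
      field_simp
    push_cast
    linarith
  exact le_of_sq_le_sq h3 (Real.exp_pos _).le

end

end GaltonWatson

namespace GaltonWatson
open PowerSeries PlaneTree MeasureTheory
open scoped Topology

section

variable {q : ℕ → ℝ} {s : ℝ}

theorem continuous_offspringChar (hs : Summable q) (hq : ∀ j, 0 ≤ q j) :
    Continuous (offspringChar q) := by
  refine continuous_tsum (fun j => by fun_prop) hs fun j θ => ?_
  simp [abs_of_nonneg (hq j)]

theorem integral_exp_int_mul {d : ℕ} (hd : 0 < d) {a : ℤ} (hda : (d : ℤ) ∣ a) :
    ∫ θ in (-(Real.pi / d))..(Real.pi / d), Complex.exp (a * Complex.I * θ)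
      = if a = 0 then ((2 * Real.pi / d : ℝ) : ℂ) else 0 := by
  have hd' : (d : ℂ) ≠ 0 := by exact_mod_cast hd.ne'
  split_ifs with ha
  · simp [ha]
    ring
  · obtain ⟨b, rfl⟩ := hda
    rw [integral_exp_mul_complex (by simpa [Complex.I_ne_zero] using ha), div_eq_zero_iff]
    left
    rw [sub_eq_zero, Complex.exp_eq_exp_iff_exists_int]
    refine ⟨b, ?_⟩
    push_cast
    field_simp
    ring

/-- Fourier inversion for the law of a random walk with steps in `dℕ`. -/
theorem walkProb_eq_integral (hs : Summable q) (hq : ∀ j, 0 ≤ q j) {d : ℕ} (hd : 0 < d)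
    (hdvd : ∀ j, q j ≠ 0 → d ∣ j) (N : ℕ) {m : ℕ} (hm : d ∣ m) :
    ((2 * Real.pi / d * walkProb q N m : ℝ) : ℂ)
      = ∫ θ in (-(Real.pi / d))..(Real.pi / d),
        offspringChar q θ ^ N * Complex.exp (-(m * θ * Complex.I)) := by
  have key : HasSum (fun l : ℕ => ∫ θ in (-(Real.pi / d))..(Real.pi / d),
      (walkProb q N l : ℂ) * Complex.exp (θ * Complex.I) ^ l * Complex.exp (-(m * θ * Complex.I)))
      (∫ θ in (-(Real.pi / d))..(Real.pi / d),
        offspringChar q θ ^ N * Complex.exp (-(m * θ * Complex.I))) := by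
    have hn (θ : ℝ) : ‖Complex.exp (-(m * θ * Complex.I))‖ = 1 := by
      have := Complex.norm_exp_ofReal_mul_I (-(m * θ))
      push_cast at this
      rwa [neg_mul] at this
    refine intervalIntegral.hasSum_integral_of_dominated_convergence
      (fun l _ => walkProb q N l) (fun l => ?_) (fun l => .of_forall fun θ _ => ?_)
      (.of_forall fun _ _ => summable_walkProb hs hq N) (by simp) (.of_forall fun θ _ => ?_)
    · exact Continuous.aestronglyMeasurable (by fun_prop)
    · simp [hn, abs_of_nonneg (walkProb_nonneg hq N l)]
    · obtain ⟨h1, h2⟩ := summable_norm_walkProb_mul_pow hs hq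
        (Complex.norm_exp_ofReal_mul_I θ) N
      rw [offspringChar, ← h2]
      exact h1.of_norm.hasSum.mul_right _
  refine HasSum.unique ?_ key
  convert hasSum_ite_eq m ((2 * Real.pi / d * walkProb q N m : ℝ) : ℂ) using 2 with l
  by_cases hl : walkProb q N l = 0
  · by_cases hlm : l = m
    · subst hlm; simp [hl]
    · simp [hl, hlm]
  have hdl : d ∣ l := dvd_of_walkProb_ne_zero hdvd hl
  have h1 (θ : ℝ) : (walkProb q N l : ℂ) * Complex.exp (θ * Complex.I) ^ l
        * Complex.exp (-(m * θ * Complex.I))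
      = walkProb q N l * Complex.exp (((l - m : ℤ) : ℂ) * Complex.I * θ) := by
    rw [← Complex.exp_nat_mul, mul_assoc, ← Complex.exp_add]
    push_cast
    ring_nf
  simp_rw [h1]
  rw [intervalIntegral.integral_const_mul, integral_exp_int_mul hd
    (dvd_sub (Int.natCast_dvd_natCast.2 hdl) (Int.natCast_dvd_natCast.2 hm))]
  by_cases hlm : l = m
  · subst hlm
    simp
    ring
  · have : (l : ℤ) - m ≠ 0 := by omega
    simp [hlm, this]

/-- The pointwise convergence behind the central limit theorem. -/
theorem IsCritical.tendsto_offspringChar_pow (h : IsCritical q s) (x : ℝ) :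
    Tendsto (fun n : ℕ => (offspringChar q (x / √n) * Complex.exp (-((x / √n : ℝ) * Complex.I))) ^ n)
      atTop (𝓝 (Real.exp (-(s / 2) * x ^ 2) : ℝ)) := by
  let μ : Measure ℝ := Measure.sum fun j : ℕ =>
    ENNReal.ofReal (q j) • Measure.dirac (((j : ℝ) - 1) / √s)
  have hne (j : ℕ) : ENNReal.ofReal (q j) ≠ ⊤ := ENNReal.ofReal_ne_top
  have hs : √s ≠ 0 := (Real.sqrt_pos.2 h.var_pos).ne'
  have hμ : IsProbabilityMeasure μ := by
    constructor
    simp only [μ, Measure.sum_apply _ MeasurableSet.univ, Measure.smul_apply, measure_univ,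
      smul_eq_mul, mul_one]
    rw [← ENNReal.ofReal_tsum_of_nonneg h.nonneg h.hasSum.summable, h.hasSum.tsum_eq]
    simp
  have h0 : ∫ y, id y ∂μ = 0 := by
    rw [integral_sum_dirac hne]
    simp only [ENNReal.toReal_ofReal (h.nonneg _), smul_eq_mul, id]
    rw [← zero_div (√s), ← h.hasSum_mean.tsum_eq, ← tsum_div_const]
    exact tsum_congr fun j => by ring
  have h1 : ∫ y, (id ^ 2 : ℝ → ℝ) y ∂μ = 1 := by
    rw [integral_sum_dirac hne]
    simp only [ENNReal.toReal_ofReal (h.nonneg _), smul_eq_mul, Pi.pow_apply, id, div_pow,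
      Real.sq_sqrt h.var_pos.le]
    exact (tsum_congr fun j => by ring).trans
      ((h.hasSum_var.div_const s).tsum_eq.trans (div_self h.var_pos.ne'))
  have key := ProbabilityTheory.tendsto_charFun_inv_sqrt_mul_pow (P := μ) aemeasurable_id h0 h1
    (√s * x)
  convert key using 2 with n
  · congr 1
    rw [Measure.map_id, charFun_apply_real, integral_sum_dirac hne, offspringChar, ← tsum_mul_right]
    refine tsum_congr fun j => ?_
    rw [ENNReal.toReal_ofReal (h.nonneg j), Complex.real_smul, mul_assoc, ← Complex.exp_nat_mul,
      ← Complex.exp_add]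
    congr 2
    have : (√s : ℂ) ≠ 0 := by exact_mod_cast hs
    push_cast
    field_simp
    ring
  · push_cast
    congr 1
    have : (√s : ℂ) ^ 2 = s := by exact_mod_cast Real.sq_sqrt h.var_pos.le
    rw [mul_pow, this]
    ring

/-- The atoms of an `N`-step random walk are uniformly of order at most `N ^ (-1 / 2)`. -/
theorem IsCritical.exists_walkProb_le (h : IsCritical q s) :
    ∃ C : ℝ, 0 < C ∧ ∀ N m : ℕ, 0 < N → walkProb q N m ≤ C / √N := by
  obtain ⟨d, hd, hdvd, c, hc, hle⟩ := h.exists_norm_offspringChar_le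
  have hd' : (0 : ℝ) < d := by exact_mod_cast hd
  have hpi := Real.pi_pos
  refine ⟨d / (2 * Real.pi) * √(Real.pi / c), by positivity, fun N m hN => ?_⟩
  have hN' : (0 : ℝ) < N := by exact_mod_cast hN
  by_cases hm : walkProb q N m = 0
  · rw [hm]; positivity
  have hb := walkProb_eq_integral h.hasSum.summable h.nonneg hd hdvd N
    (dvd_of_walkProb_ne_zero hdvd hm)
  have h1 : ‖((2 * Real.pi / d * walkProb q N m : ℝ) : ℂ)‖ ≤ √(Real.pi / (N * c)) := by
    rw [hb, ← integral_gaussian]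
    have hab : -(Real.pi / d) ≤ Real.pi / d := by linarith [show 0 < Real.pi / d by positivity]
    have hint := integrable_exp_neg_mul_sq (show 0 < N * c by positivity)
    calc _ ≤ ∫ θ in (-(Real.pi / d))..(Real.pi / d), Real.exp (-(N * c) * θ ^ 2) := by
          refine intervalIntegral.norm_integral_le_of_norm_le hab (.of_forall fun θ hθ => ?_)
            hint.intervalIntegrable
          have hn : ‖Complex.exp (-(m * θ * Complex.I))‖ = 1 := by
            have := Complex.norm_exp_ofReal_mul_I (-(m * θ))
            push_cast at this
            rwa [neg_mul] at this
          rw [norm_mul, norm_pow, hn, mul_one]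
          refine (pow_le_pow_left₀ (norm_nonneg _)
            (hle θ (abs_le.2 ⟨hθ.1.le, hθ.2⟩)) N).trans_eq ?_
          rw [← Real.exp_nat_mul]
          ring_nf
      _ ≤ _ := by
          rw [intervalIntegral.integral_of_le hab]
          exact setIntegral_le_integral hint (.of_forall fun θ => (Real.exp_pos _).le)
  rw [Complex.norm_real, Real.norm_of_nonneg
    (mul_nonneg (by positivity) (walkProb_nonneg h.nonneg N m))] at h1
  have h2 : √(Real.pi / (N * c)) = √(Real.pi / c) / √N := by
    rw [← Real.sqrt_div (by positivity)]
    congr 1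
    field_simp
  rw [h2] at h1
  calc walkProb q N m = d / (2 * Real.pi) * (2 * Real.pi / d * walkProb q N m) := by field_simp
    _ ≤ d / (2 * Real.pi) * (√(Real.pi / c) / √N) := by gcongr
    _ = _ := by ring

/-- The lower bound from the local limit theorem for the probability of the total progeny,
along the lattice of admissible values. -/
theorem IsCritical.exists_le_walkProb (h : IsCritical q s) :
    ∃ c : ℝ, 0 < c ∧ ∀ n : ℕ, walkProb q (n + 1) n ≠ 0 → c / √((n : ℝ) + 1) ≤ walkProb q (n + 1) n := by
  obtain ⟨d, hd, hdvd, c, hc, hle⟩ := h.exists_norm_offspringChar_le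
  have hd' : (0 : ℝ) < d := by exact_mod_cast hd
  have hpi := Real.pi_pos
  have hs := h.var_pos
  let F (n : ℕ) (θ : ℝ) : ℂ := offspringChar q θ ^ (n + 1) * Complex.exp (-(n * θ * Complex.I))
  let G (n : ℕ) : ℝ → ℂ := (Ioc (-(Real.pi / d)) (Real.pi / d)).indicator (F n)
  have hFeq (n : ℕ) (θ : ℝ) : F n θ = (offspringChar q θ * Complex.exp (-(θ * Complex.I))) ^ (n + 1)
      * Complex.exp (θ * Complex.I) := by
    simp only [F]
    rw [mul_pow, mul_assoc (_ ^ (n + 1)), ← Complex.exp_nat_mul, ← Complex.exp_add]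
    push_cast
    ring_nf
  have hsq (n : ℕ) : 0 < √((n + 1 : ℕ) : ℝ) := Real.sqrt_pos.2 (by positivity)
  have hlim : Tendsto (fun n : ℕ => ∫ x, G n (x / √((n + 1 : ℕ) : ℝ))) atTop
      (𝓝 (∫ x, ((Real.exp (-(s / 2) * x ^ 2) : ℝ) : ℂ))) := by
    refine tendsto_integral_of_dominated_convergence (fun x => Real.exp (-c * x ^ 2)) (fun n => ?_)
      (integrable_exp_neg_mul_sq hc) (fun n => .of_forall fun x => ?_) (.of_forall fun x => ?_)
    · have hF : Measurable (F n) := Continuous.measurable <| by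
        have := continuous_offspringChar h.hasSum.summable h.nonneg
        fun_prop
      exact ((hF.indicator measurableSet_Ioc).comp (by fun_prop)).aestronglyMeasurable
    · by_cases hx : x / √((n + 1 : ℕ) : ℝ) ∈ Ioc (-(Real.pi / d)) (Real.pi / d)
      · simp only [G, indicator_of_mem hx, hFeq]
        have hn : ‖Complex.exp (-(((x / √((n + 1 : ℕ) : ℝ) : ℝ) : ℂ) * Complex.I))‖ = 1 := by
          have := Complex.norm_exp_ofReal_mul_I (-(x / √((n + 1 : ℕ) : ℝ)))
          rwa [Complex.ofReal_neg, neg_mul] at this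
        rw [norm_mul, Complex.norm_exp_ofReal_mul_I, mul_one, norm_pow, norm_mul, hn, mul_one]
        refine (pow_le_pow_left₀ (norm_nonneg _)
          (hle _ (abs_le.2 ⟨hx.1.le, hx.2⟩)) (n + 1)).trans_eq ?_
        rw [← Real.exp_nat_mul, div_pow, Real.sq_sqrt (by positivity)]
        congr 1
        field_simp
      · simp only [G, indicator_of_notMem hx, norm_zero]
        positivity
    · have h0 : Tendsto (fun n : ℕ => x / √((n + 1 : ℕ) : ℝ)) atTop (𝓝 0) :=
        tendsto_const_nhds.div_atTop <| Real.tendsto_sqrt_atTop.comp <|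
          tendsto_natCast_atTop_atTop.comp (tendsto_add_atTop_nat 1)
      have h1 := (h.tendsto_offspringChar_pow x).comp (tendsto_add_atTop_nat 1)
      have h2 : Tendsto (fun n : ℕ => Complex.exp (((x / √((n + 1 : ℕ) : ℝ) : ℝ) : ℂ) * Complex.I))
          atTop (𝓝 1) := by
        have : Continuous fun y : ℝ => Complex.exp (y * Complex.I) := by fun_prop
        simpa [Function.comp_def] using (this.tendsto 0).comp h0
      have h3 := h1.mul h2
      rw [mul_one] at h3
      refine h3.congr' ?_
      have hpos : 0 < Real.pi / d := by positivity
      filter_upwards [h0.eventually (Ioo_mem_nhds (neg_lt_zero.2 hpos) hpos)] with n hn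
      simp only [G, indicator_of_mem (Ioo_subset_Ioc_self hn), hFeq, Function.comp_apply]
  have hL : ∫ x, ((Real.exp (-(s / 2) * x ^ 2) : ℝ) : ℂ) = ((√(Real.pi / (s / 2)) : ℝ) : ℂ) := by
    rw [integral_complex_ofReal, integral_gaussian]
  have hLpos : 0 < √(Real.pi / (s / 2)) := Real.sqrt_pos.2 (by positivity)
  have hint (n : ℕ) (hn : d ∣ n) : ∫ x, G n (x / √((n + 1 : ℕ) : ℝ))
      = ((√((n + 1 : ℕ) : ℝ) * (2 * Real.pi / d * walkProb q (n + 1) n) : ℝ) : ℂ) := by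
    have hab : -(Real.pi / d) ≤ Real.pi / d := by linarith [show 0 < Real.pi / d by positivity]
    rw [Measure.integral_comp_div (G n), abs_of_pos (hsq n), integral_indicator measurableSet_Ioc,
      ← intervalIntegral.integral_of_le hab, Complex.ofReal_mul,
      walkProb_eq_integral h.hasSum.summable h.nonneg hd hdvd (n + 1) hn, Complex.real_smul]
  rw [hL] at hlim
  have hev := hlim.norm.eventually_const_lt
    (u := √(Real.pi / (s / 2)) / 2) (by
      rw [Complex.norm_real, Real.norm_of_nonneg hLpos.le]; linarith)
  obtain ⟨n₀, hn₀⟩ := eventually_atTop.1 hev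
  have hfin : ∃ c₁ : ℝ, 0 < c₁ ∧ ∀ n < n₀, walkProb q (n + 1) n ≠ 0 →
      c₁ ≤ walkProb q (n + 1) n * √((n : ℝ) + 1) := by
    clear hn₀
    induction n₀ with
    | zero => exact ⟨1, one_pos, by simp⟩
    | succ k ih =>
      obtain ⟨c₁, hc₁, ih⟩ := ih
      by_cases hk : walkProb q (k + 1) k = 0
      · refine ⟨c₁, hc₁, fun n hn hne => ih n ?_ hne⟩
        exact lt_of_le_of_ne (Nat.lt_succ_iff.1 hn) (by rintro rfl; exact hne hk)
      · have : 0 < walkProb q (k + 1) k * √((k : ℝ) + 1) :=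
          mul_pos ((walkProb_nonneg h.nonneg _ _).lt_of_ne' hk) (Real.sqrt_pos.2 (by positivity))
        refine ⟨min c₁ _, lt_min hc₁ this, fun n hn hne => ?_⟩
        rcases (Nat.lt_succ_iff.1 hn).lt_or_eq with hn | rfl
        · exact (min_le_left _ _).trans (ih n hn hne)
        · exact min_le_right _ _
  obtain ⟨c₁, hc₁, hfin⟩ := hfin
  refine ⟨min c₁ (d / (2 * Real.pi) * (√(Real.pi / (s / 2)) / 2)), by positivity,
    fun n hne => ?_⟩
  rw [div_le_iff₀ (Real.sqrt_pos.2 (by positivity))]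
  rcases lt_or_ge n n₀ with hn | hn
  · exact (min_le_left _ _).trans (hfin n hn hne)
  · refine (min_le_right _ _).trans ?_
    have h1 := hn₀ n hn
    rw [hint n (dvd_of_walkProb_ne_zero hdvd hne), Complex.norm_real, Real.norm_of_nonneg
      (mul_nonneg (hsq n).le (mul_nonneg (by positivity) (walkProb_nonneg h.nonneg _ _)))] at h1
    push_cast at h1
    calc _ ≤ d / (2 * Real.pi) * (√((n : ℝ) + 1) * (2 * Real.pi / d * walkProb q (n + 1) n)) := by
          gcongr
      _ = _ := by field_simp

end

end GaltonWatson

namespace GaltonWatson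
open PowerSeries PlaneTree
open scoped Topology

section

variable {q : ℕ → ℝ} {s : ℝ}

theorem one_sub_pow_le {ε : ℝ} (h0 : 0 ≤ ε) (h1 : ε ≤ 1) (j : ℕ) :
    (1 - ε) ^ j ≤ 1 - j * ε + (j * (j - 1) : ℝ) / 2 * ε ^ 2 := by
  induction j with
  | zero => simp
  | succ j ih =>
    have hj : 0 ≤ (j * (j - 1) : ℝ) := by
      rcases Nat.eq_zero_or_pos j with rfl | hj
      · simp
      · have : (1 : ℝ) ≤ j := by exact_mod_cast hj
        exact mul_nonneg (by positivity) (by linarith)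
    have h2 := mul_le_mul_of_nonneg_right ih (sub_nonneg.2 h1)
    have h3 : 0 ≤ (j * (j - 1) : ℝ) / 2 * ε ^ 2 * ε := by positivity
    rw [pow_succ]
    push_cast
    nlinarith

/-- A point of `(0, 1]` at which `φ φ' < x`. -/
theorem IsCritical.exists_mul_deriv_lt (h : IsCritical q s) :
    ∃ x φ φ' : ℝ, 0 < x ∧ x ≤ 1 ∧ HasSum (fun j => q j * x ^ j) φ ∧
      HasSum (fun j : ℕ => j * q j * x ^ (j - 1)) φ' ∧ x ≤ φ ∧ 0 ≤ φ' ∧ φ' ≤ 1 ∧ φ * φ' < x := by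
  obtain ⟨i, hi, hqi⟩ := h.exists_two_le
  have hi' : (2 : ℝ) ≤ i := by exact_mod_cast hi
  have hs := h.var_pos
  have hmean : HasSum (fun j : ℕ => j * q j) 1 := by
    convert h.hasSum_mean.add h.hasSum using 2 with j
    · ring
    · simp
  have hnn (j : ℕ) : 0 ≤ j * q j := mul_nonneg (by positivity) (h.nonneg j)
  set a : ℝ := i * q i with ha
  have ha0 : 0 < a := by positivity
  have ha1 : a ≤ 1 := le_hasSum hmean i fun j _ => hnn j
  set ε : ℝ := a / (s + 2) with hε
  have hε0 : 0 < ε := by positivity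
  have hε2 : ε * (s + 2) = a := by rw [hε]; field_simp
  have hε1 : ε ≤ 1 / 2 := by nlinarith
  have hx0 : 0 ≤ 1 - ε := by linarith
  have hx1 : 1 - ε ≤ 1 := by linarith
  have hφ : Summable fun j => q j * (1 - ε) ^ j :=
    h.hasSum.summable.of_nonneg_of_le (fun j => mul_nonneg (h.nonneg j) (by positivity))
      fun j => mul_le_of_le_one_right (h.nonneg j) (pow_le_one₀ hx0 hx1)
  have hφ' : Summable fun j : ℕ => j * q j * (1 - ε) ^ (j - 1) :=
    hmean.summable.of_nonneg_of_le (fun j => mul_nonneg (hnn j) (by positivity))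
      fun j => mul_le_of_le_one_right (hnn j) (pow_le_one₀ hx0 hx1)
  have hlow : 1 - ε ≤ ∑' j, q j * (1 - ε) ^ j := by
    have h1 : HasSum (fun j : ℕ => q j - j * q j * ε) (1 - 1 * ε) :=
      h.hasSum.sub (hmean.mul_right ε)
    rw [one_mul] at h1
    refine hasSum_le (fun j => ?_) h1 hφ.hasSum
    have := mul_le_mul_of_nonneg_left (one_add_mul_le_pow (show -2 ≤ -ε by linarith) j)
      (h.nonneg j)
    rw [← sub_eq_add_neg] at this
    linarith
  have hup : ∑' j, q j * (1 - ε) ^ j ≤ 1 - ε + s / 2 * ε ^ 2 := by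
    have h1 : HasSum (fun j : ℕ => q j - j * q j * ε
        + (q j * ((j : ℝ) - 1) ^ 2 + q j * ((j : ℝ) - 1)) * (ε ^ 2 / 2))
        (1 - 1 * ε + (s + 0) * (ε ^ 2 / 2)) :=
      (h.hasSum.sub (hmean.mul_right ε)).add ((h.hasSum_var.add h.hasSum_mean).mul_right _)
    refine (hasSum_le (fun j => ?_) hφ.hasSum h1).trans_eq (by ring)
    refine (mul_le_mul_of_nonneg_left (one_sub_pow_le hε0.le (by linarith) j)
      (h.nonneg j)).trans_eq (by ring)
  have hup' : ∑' j : ℕ, j * q j * (1 - ε) ^ (j - 1) ≤ 1 - a * ε := by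
    have h1 : HasSum (fun j : ℕ => j * q j - if j = i then a * ε else 0) (1 - a * ε) :=
      hmean.sub (hasSum_ite_eq i _)
    refine hasSum_le (fun j => ?_) hφ'.hasSum h1
    split_ifs with hj
    · subst hj
      have : (1 - ε) ^ (j - 1) ≤ 1 - ε := pow_le_of_le_one hx0 hx1 (by omega)
      nlinarith
    · rw [sub_zero]
      exact mul_le_of_le_one_right (hnn j) (pow_le_one₀ hx0 hx1)
  have hφ'0 : 0 ≤ ∑' j : ℕ, j * q j * (1 - ε) ^ (j - 1) :=
    tsum_nonneg fun j => mul_nonneg (hnn j) (by positivity)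
  refine ⟨1 - ε, _, _, by linarith, hx1, hφ.hasSum, hφ'.hasSum, hlow, hφ'0, ?_, ?_⟩
  · nlinarith
  · have hpos : 0 ≤ 1 - ε + s / 2 * ε ^ 2 := by positivity
    refine (mul_le_mul hup hup' hφ'0 hpos).trans_lt ?_
    have e1 : s * ε = a - 2 * ε := by linarith
    have e2 : (1 - ε + s / 2 * ε ^ 2) * (1 - a * ε)
        = 1 - ε + ε * (s * ε / 2 - a * (1 - ε) - a * (s * ε) * ε / 2) := by ring
    have e3 : s * ε / 2 - a * (1 - ε) - a * (s * ε) * ε / 2 < 0 := by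
      have : 0 ≤ a * (s * ε) * ε / 2 := by positivity
      nlinarith
    rw [e2]
    nlinarith

end

section

variable {p : ℕ → ℝ≥0∞}

theorem coeff_offspringGF_pow (hp : ∀ j, p j ≠ ⊤) (N m : ℕ) :
    coeff m (offspringGF p ^ N) = ENNReal.ofReal (walkProb (fun j => (p j).toReal) N m) := by
  have hq (j : ℕ) : 0 ≤ (p j).toReal := ENNReal.toReal_nonneg
  induction N generalizing m with
  | zero => rw [walkProb, pow_zero, pow_zero, coeff_one, coeff_one]; split_ifs <;> simp
  | succ N ih =>
    rw [walkProb_succ, ENNReal.ofReal_sum_of_nonneg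
      fun x _ => mul_nonneg (walkProb_nonneg hq N _) (hq _), pow_succ, coeff_mul]
    refine Finset.sum_congr rfl fun x _ => ?_
    rw [ih, ENNReal.ofReal_mul (walkProb_nonneg hq N _), ENNReal.ofReal_toReal (hp _),
      offspringGF, coeff_mk]

theorem ne_top_of_tsum_eq_one (hp : ∑' k : ℕ, p k = 1) (j : ℕ) : p j ≠ ⊤ :=
  ENNReal.ne_top_of_tsum_ne_top (by simp [hp]) j

theorem isCritical_toReal (hp : ∑' k : ℕ, p k = 1) (hmean : ∑' k : ℕ, (k : ℝ≥0∞) * p k = 1)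
    (hvar_pos : 0 < xiVar p) (hvar_fin : xiVar p ≠ ⊤) :
    IsCritical (fun j => (p j).toReal) (xiVar p).toReal := by
  have hasSum {f : ℕ → ℝ≥0∞} {a : ℝ≥0∞} (ha : a ≠ ⊤) (hf : ∑' j, f j = a) :
      HasSum (fun j => (f j).toReal) a.toReal := by
    rw [← hf, ENNReal.tsum_toReal_eq (ENNReal.ne_top_of_tsum_ne_top (hf ▸ ha))]
    exact (ENNReal.summable_toReal (hf ▸ ha)).hasSum
  have h1 : HasSum (fun j => (p j).toReal) 1 := by simpa using hasSum (by simp) hp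
  have h2 : HasSum (fun j : ℕ => j * (p j).toReal) 1 := by simpa using hasSum (by simp) hmean
  refine ⟨fun j => ENNReal.toReal_nonneg, h1, ?_, ?_, ENNReal.toReal_pos hvar_pos.ne' hvar_fin⟩
  · simpa [mul_sub, mul_comm] using h2.sub h1
  · convert hasSum hvar_fin rfl using 2 with j
    rw [ENNReal.toReal_mul, ENNReal.toReal_ofReal (sq_nonneg _)]

theorem tsum_mul_pred_ne_top (hmean : ∑' k : ℕ, (k : ℝ≥0∞) * p k = 1) (hvar_fin : xiVar p ≠ ⊤) :
    ∑' j : ℕ, ((j * (j - 1) : ℕ) : ℝ≥0∞) * p j ≠ ⊤ := by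
  have h : ∑' j : ℕ, ((j * (j - 1) : ℕ) : ℝ≥0∞) * p j ≤ xiVar p + 1 := by
    rw [← hmean, xiVar, ← ENNReal.tsum_add]
    refine ENNReal.tsum_le_tsum fun j => ?_
    rw [mul_comm (p j), ← add_mul]
    gcongr
    rw [← ENNReal.ofReal_natCast, ← ENNReal.ofReal_natCast j,
      ← ENNReal.ofReal_add (sq_nonneg _) (by positivity)]
    refine ENNReal.ofReal_le_ofReal ?_
    cases j with
    | zero => simp
    | succ j =>
      push_cast
      simp only [add_tsub_cancel_right]
      nlinarith
  exact ne_top_of_le_ne_top (by simpa using hvar_fin) h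

theorem exists_two_mul_add_one_mul_pow_le {ρ : ℝ} (h0 : 0 ≤ ρ) (h1 : ρ < 1) :
    ∃ C : ℝ, 0 < C ∧ ∀ k : ℕ, (2 * k + 1) * ρ ^ k ≤ C := by
  obtain ⟨B, hB⟩ := (tendsto_self_mul_const_pow_of_lt_one h0 h1).bddAbove_range
  have hB' (k : ℕ) : k * ρ ^ k ≤ B := hB (mem_range_self k)
  have : 0 ≤ B := by simpa using hB' 0
  refine ⟨2 * B + 1, by positivity, fun k => ?_⟩
  have := pow_le_one₀ (n := k) h0 h1.le
  linarith [hB' k]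

/-- Decay of the coefficients counting trees with a marked spine of length `k`, uniformly in the
length of the spine. -/
theorem exists_coeff_pow_mul_spineGF_pow_le (hp : ∑' k : ℕ, p k = 1)
    (hmean : ∑' k : ℕ, (k : ℝ≥0∞) * p k = 1) {s : ℝ}
    (hq : IsCritical (fun j => (p j).toReal) s) {Y : ℝ≥0∞⟦X⟧} (hY : Y = X * powSum p id Y) :
    ∃ C : ℝ, 0 < C ∧ ∀ r k n : ℕ, coeff n (Y ^ r * spineGF p Y ^ k * geomSum (spineGF p Y))
      ≤ ENNReal.ofReal (C / √((n : ℝ) + 1)) := by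
  have hpt := ne_top_of_tsum_eq_one hp
  obtain ⟨C₁, hC₁, hwalk⟩ := hq.exists_walkProb_le
  obtain ⟨x, φ, φ', hx, hx1, hφ, hφ', hle, hφ'0, hφ'1, hlt⟩ := hq.exists_mul_deriv_lt
  have hφ0 : 0 ≤ φ := hx.le.trans hle
  obtain ⟨C₂, hC₂, hgeom⟩ := exists_two_mul_add_one_mul_pow_le
    (ρ := φ * φ' / x) (by positivity) ((div_lt_one hx).2 hlt)
  refine ⟨2 * C₁ + C₂, by positivity, fun r k n => ?_⟩
  rcases lt_or_ge n k with hk | hk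
  · rw [coeff_pow_mul_spineGF_pow_eq_zero _ hk]
    exact zero_le
  obtain ⟨N, rfl⟩ := Nat.exists_eq_add_of_le' hk
  have hsq : 0 < √(((N + k : ℕ) : ℝ) + 1) := Real.sqrt_pos.2 (by positivity)
  rcases le_or_gt N k with hNk | hNk
  · have e1 : ∑' j, p j * ENNReal.ofReal x ^ j = ENNReal.ofReal φ := by
      rw [← hφ.tsum_eq, ENNReal.ofReal_tsum_of_nonneg (fun j => by positivity) hφ.summable]
      refine tsum_congr fun j => ?_
      rw [ENNReal.ofReal_mul (by positivity), ENNReal.ofReal_toReal (hpt j),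
        ENNReal.ofReal_pow hx.le]
    have e2 : ∑' j : ℕ, j * p j * ENNReal.ofReal x ^ (j - 1) = ENNReal.ofReal φ' := by
      rw [← hφ'.tsum_eq, ENNReal.ofReal_tsum_of_nonneg (fun j => by positivity) hφ'.summable]
      refine tsum_congr fun j => ?_
      rw [ENNReal.ofReal_mul (by positivity), ENNReal.ofReal_mul (by positivity),
        ENNReal.ofReal_toReal (hpt j), ENNReal.ofReal_pow hx.le, ENNReal.ofReal_natCast]
    have h1 := coeff_pow_mul_spineGF_pow_mul_le hY (x := ENNReal.ofReal x) N k r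
    rw [e1, e2, ← ENNReal.ofReal_mul hx.le, ← ENNReal.ofReal_pow hx.le, ← ENNReal.ofReal_pow hx.le,
      ← ENNReal.ofReal_pow (by positivity), ← ENNReal.ofReal_pow hφ0,
      ← ENNReal.ofReal_mul (by positivity), ← ENNReal.ofReal_mul (by positivity)] at h1
    rw [← ENNReal.le_div_iff_mul_le (by simp [hx]) (by simp),
      ← ENNReal.ofReal_div_of_pos (by positivity)] at h1
    refine h1.trans (ENNReal.ofReal_le_ofReal ?_)
    rw [le_div_iff₀ hsq]
    calc x ^ r * (x * φ') ^ k * φ ^ N / x ^ (N + k) * √(((N + k : ℕ) : ℝ) + 1)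
        ≤ 1 * (x * φ') ^ k * φ ^ N / x ^ (N + k) * (2 * k + 1) := by
          gcongr
          · exact pow_le_one₀ hx.le hx1
          · have : (N : ℝ) ≤ k := by exact_mod_cast hNk
            refine Real.sqrt_le_iff.2 ⟨by positivity, ?_⟩
            push_cast
            nlinarith
      _ = φ' ^ k * (φ / x) ^ N * (2 * k + 1) := by
          rw [mul_pow, div_pow, pow_add]
          field_simp
      _ ≤ φ' ^ k * (φ / x) ^ k * (2 * k + 1) := by
          gcongr
          exact (one_le_div hx).2 hle
      _ = (2 * k + 1) * (φ * φ' / x) ^ k := by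
          rw [← mul_pow]
          ring
      _ ≤ 2 * C₁ + C₂ := by linarith [hgeom k]
  · refine coeff_pow_mul_spineGF_pow_le hmean hY (fun m => ?_) r
    rw [coeff_offspringGF_pow hpt]
    have hN : (0 : ℝ) < N := by exact_mod_cast Nat.zero_lt_of_lt hNk
    have hsN : 0 < √(N : ℝ) := Real.sqrt_pos.2 hN
    refine ENNReal.ofReal_le_ofReal ((hwalk N m (Nat.zero_lt_of_lt hNk)).trans ?_)
    rw [div_le_div_iff₀ hsN hsq]
    have h2 : √(((N + k : ℕ) : ℝ) + 1) ≤ 2 * √N := by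
      have : (k : ℝ) + 1 ≤ N := by exact_mod_cast hNk
      refine Real.sqrt_le_iff.2 ⟨by positivity, ?_⟩
      rw [mul_pow, Real.sq_sqrt hN.le]
      push_cast
      linarith
    nlinarith

end

end GaltonWatson

/-- Corollary 1 of Devroye–Janson.  `E Z_k(T_n^*) ≤ C k`, uniformly in
`k, n ≥ 1`, where `T_n^*` is the conditioned Galton–Watson tree `T_n` rerooted at a
uniformly random vertex; thus `Z_k(T_n^*)` averages, over the `n` vertices `v` of `T_n`,
the number of vertices at distance `k` from `v`. -/
theorem expected_rerootedZ_le
    (p : ℕ → ℝ≥0∞) (hp : ∑' k : ℕ, p k = 1)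
    (hmean : ∑' k : ℕ, (k : ℝ≥0∞) * p k = 1)
    (hvar_pos : 0 < xiVar p) (hvar_fin : xiVar p ≠ ⊤) :
    ∃ C : ℝ, 0 < C ∧ ∀ k n : ℕ, 1 ≤ k → 1 ≤ n → probSize p n ≠ 0 →
      condExp p n (fun t => ∑ᶠ v ∈ PlaneTree.vertexSet t, (rerootedZ t v k : ℝ≥0∞)) / n
        ≤ ENNReal.ofReal (C * k) := by
  have hpt := GaltonWatson.ne_top_of_tsum_eq_one hp
  have hq := GaltonWatson.isCritical_toReal hp hmean hvar_pos hvar_fin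
  have hV := GaltonWatson.tsum_mul_pred_ne_top hmean hvar_fin
  obtain ⟨C, hC, hupper⟩ := GaltonWatson.exists_coeff_pow_mul_spineGF_pow_le hp hmean hq
    GaltonWatson.treeGF_one_eq
  obtain ⟨c, hc, hlower⟩ := hq.exists_le_walkProb
  set V := (∑' j : ℕ, ((j * (j - 1) : ℕ) : ℝ≥0∞) * p j).toReal with hVdef
  have hV0 : 0 ≤ V := ENNReal.toReal_nonneg
  refine ⟨(2 + V) * C / c, by positivity, fun k n hk hn hne => ?_⟩
  obtain ⟨k, rfl⟩ := Nat.exists_eq_add_of_le' hk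
  obtain ⟨n, rfl⟩ := Nat.exists_eq_add_of_le' hn
  have hsq : 0 < √((n : ℝ) + 1) := Real.sqrt_pos.2 (by positivity)
  have hnum : (∑' t : PlaneTree, if PlaneTree.size t = n + 1 then gwProb p t *
      ∑ᶠ v ∈ PlaneTree.vertexSet t, (rerootedZ t v (k + 1) : ℝ≥0∞) else 0)
      ≤ ENNReal.ofReal ((2 + k * V) * (C / √((n : ℝ) + 1))) := by
    refine (PowerSeries.coeff_mk (n + 1) fun l => ∑' t : PlaneTree, if PlaneTree.size t = l then
      gwProb p t * PlaneTree.distCount (k + 1) t else 0).symm.trans_le ?_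
    refine (GaltonWatson.coeff_treeGF_distCount_succ_le (n := n) (fun r l m hnm _ =>
      (hupper r l m).trans (ENNReal.ofReal_le_ofReal (?_ : _ ≤ C / √((n : ℝ) + 1)))) k).trans_eq ?_
    · gcongr
    · rw [← ENNReal.ofReal_toReal hV, ← hVdef, add_mul, ENNReal.ofReal_add (by positivity)
        (by positivity), ENNReal.ofReal_mul (by positivity), ENNReal.ofReal_mul (by positivity),
        ENNReal.ofReal_mul (by positivity)]
      simp [mul_assoc]
  have hden : ((n + 1 : ℕ) : ℝ≥0∞) * probSize p (n + 1)
      = ENNReal.ofReal (GaltonWatson.walkProb (fun j => (p j).toReal) (n + 1) n) := by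
    rw [GaltonWatson.natCast_mul_probSize, PowerSeries.coeff_succ_X_mul,
      GaltonWatson.coeff_offspringGF_pow hpt]
  have hwalk : GaltonWatson.walkProb (fun j => (p j).toReal) (n + 1) n ≠ 0 := by
    intro h0
    rw [h0, ENNReal.ofReal_zero, mul_eq_zero] at hden
    exact hden.elim (by simp) hne
  have hden_le : ENNReal.ofReal (c / √((n : ℝ) + 1))
      ≤ probSize p (n + 1) * ((n + 1 : ℕ) : ℝ≥0∞) := by
    rw [mul_comm, hden]
    exact ENNReal.ofReal_le_ofReal (hlower n hwalk)
  rw [condExp, div_eq_mul_inv, div_eq_mul_inv, mul_assoc, ← ENNReal.mul_inv (.inl hne) (.inr (by simp)),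
    ← div_eq_mul_inv]
  refine ENNReal.div_le_of_le_mul (hnum.trans ?_)
  refine le_trans ?_ (mul_le_mul_right hden_le _)
  rw [← ENNReal.ofReal_mul (by positivity)]
  refine ENNReal.ofReal_le_ofReal ?_
  have e : (2 + V) * C / c * ((k + 1 : ℕ) : ℝ) * (c / √((n : ℝ) + 1))
      = (2 + V) * (k + 1) * (C / √((n : ℝ) + 1)) := by
    push_cast
    field_simp
  rw [e]
  gcongr
  nlinarith
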